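/- Let ρ₁ ≤ ρ₂ ≤ ρ₃ be real numbers with ρ₁ + ρ₂ + ρ₃ = 0, let B ⊂ ℝ³ be the open unit ball, and define f(W) := 2 Σ_{i=1}^{3} (λ_i(W_sym) − ρ_i)² for W ∈ ℝ^{3×3}. For Z ∈ ℝ^{3×3} with tr Z = 0, write λ_i := λ_i(Z_sym) and define g(Z) := inf { (1/|B|) ∫_B f(Z + ∇φ(y)) dy : φ ∈ C_c^∞(B; ℝ³), div φ = 0 }. Then: g(Z) = 0 if λ₁ ≥ ρ₁ and λ₃ ≤ ρ₃; g(Z) = 3(λ₁ − ρ₁)² if λ₁ ≤ ρ₁ and λ₃ − ρ₃ ≤ λ₂ − ρ₂; g(Z) = f(Z) if λ₁ − ρ₁ ≤ λ₂ − ρ₂ ≤ λ₃ − ρ₃; and g(Z) = 3(λ₃ − ρ₃)² if λ₂ − ρ₂ ≤ λ₁ − ρ₁ and λ₃ ≥ ρ₃. -/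

import Mathlib

open MeasureTheory Filter Matrix

noncomputable def frobSq {n : ℕ} (X : Matrix (Fin n) (Fin n) ℝ) : ℝ := ∑ i, ∑ j, (X i j)^2
noncomputable def frob {n : ℕ} (X : Matrix (Fin n) (Fin n) ℝ) : ℝ := Real.sqrt (frobSq X)
noncomputable def msym {n : ℕ} (X : Matrix (Fin n) (Fin n) ℝ) : Matrix (Fin n) (Fin n) ℝ :=
  (1/2 : ℝ) • (X + Xᵀ)
noncomputable def mdev {n : ℕ} (X : Matrix (Fin n) (Fin n) ℝ) : Matrix (Fin n) (Fin n) ℝ :=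
  X - (X.trace / n) • (1 : Matrix (Fin n) (Fin n) ℝ)
noncomputable def mils {n : ℕ} (X : Matrix (Fin n) (Fin n) ℝ) : Matrix (Fin n) (Fin n) ℝ :=
  msym X - (X.trace / n) • (1 : Matrix (Fin n) (Fin n) ℝ)

/-- Matrix exponential, defined by its power series. -/
noncomputable def mexp {n : ℕ} (A : Matrix (Fin n) (Fin n) ℝ) : Matrix (Fin n) (Fin n) ℝ :=
  ∑' k : ℕ, ((k.factorial : ℝ)⁻¹) • A ^ k

/-- The eigenvalues of a symmetric real matrix, listed in ascending order
(and junk value `0` if the matrix is not symmetric). -/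
noncomputable def sortedEig {n : ℕ} (A : Matrix (Fin n) (Fin n) ℝ) : Fin n → ℝ :=
  if hA : A.IsHermitian then fun i => hA.eigenvalues (Tuple.sort hA.eigenvalues i) else 0

/-- The singular values of a real square matrix in ascending order. -/
noncomputable def singVals {n : ℕ} (X : Matrix (Fin n) (Fin n) ℝ) : Fin n → ℝ :=
  fun i => Real.sqrt (sortedEig (Xᵀ * X) i)

/-- The Jacobian matrix of a map `ℝ^n → ℝ^n`. -/
noncomputable def jac {n : ℕ} (u : EuclideanSpace ℝ (Fin n) → EuclideanSpace ℝ (Fin n))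
    (x : EuclideanSpace ℝ (Fin n)) : Matrix (Fin n) (Fin n) ℝ :=
  fun i j => fderiv ℝ u x (EuclideanSpace.single j 1) i

/-- The linearized nematic elastomer density. -/
noncomputable def nemV (ρ : Fin 3 → ℝ) (W : Matrix (Fin 3) (Fin 3) ℝ) : ℝ :=
  2 * ∑ i, (sortedEig (msym W) i - ρ i) ^ 2

/-- A smooth approximation `h` of the square wave `sign ∘ cos`, together with a bounded primitive
`G` and a primitive `H` of `G`. -/
theorem exists_smoothed_square_wave {κ δ : ℝ} (hκ : 0 < κ) (hδ : 0 < δ) :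
    ∃ H G h : ℝ → ℝ, ContDiff ℝ (⊤ : ℕ∞) H ∧ ContDiff ℝ (⊤ : ℕ∞) G ∧ Continuous h ∧
      (∀ s, HasDerivAt H (G s) s) ∧ (∀ s, HasDerivAt G (h s) s) ∧
      (∀ s, |G s| ≤ 2) ∧ (∀ s, |H s| ≤ 2 * |s|) ∧ (∀ s, |h s| ≤ 1) ∧
      ∀ s, κ ≤ |Real.cos s| → 1 - δ ≤ |h s| := by
  set p : ℝ := δ * κ ^ 2 with hp
  have hp0 : 0 < p := by positivity
  set c : ℝ := (√(1 + p))⁻¹ with hc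
  have hsq : 1 < √(1 + p) := by
    rw [Real.lt_sqrt (by norm_num)]; linarith
  have hc0 : 0 < c := by positivity
  have hc1 : c < 1 := inv_lt_one_of_one_lt₀ hsq
  have hc2 : c ^ 2 = (1 + p)⁻¹ := by
    rw [hc, inv_pow, Real.sq_sqrt (by positivity)]
  have habs : ∀ s, |c * Real.sin s| < 1 := fun s => by
    rw [abs_mul, abs_of_pos hc0]
    nlinarith [Real.abs_sin_le_one s, abs_nonneg (Real.sin s)]
  have hne : ∀ s, c * Real.sin s ≠ -1 ∧ c * Real.sin s ≠ 1 := fun s =>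
    ⟨(abs_lt.1 (habs s)).1.ne', (abs_lt.1 (habs s)).2.ne⟩
  set G : ℝ → ℝ := fun s => Real.arcsin (c * Real.sin s) with hG
  set h : ℝ → ℝ := fun s => Real.cos s / √(p + Real.cos s ^ 2) with hh
  have hpos : ∀ s, 0 < p + Real.cos s ^ 2 := fun s => by positivity
  have hGs : ContDiff ℝ (⊤ : ℕ∞) G := by
    rw [contDiff_iff_contDiffAt]
    intro s
    exact ContDiffAt.comp (g := Real.arcsin) s (Real.contDiffAt_arcsin (hne s).1 (hne s).2)
      (contDiff_const.mul Real.contDiff_sin).contDiffAt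
  have hGb : ∀ s, |G s| ≤ 2 := fun s => by
    rw [abs_le]
    have h1 := Real.neg_pi_div_two_le_arcsin (c * Real.sin s)
    have h2 := Real.arcsin_le_pi_div_two (c * Real.sin s)
    have h3 := Real.pi_le_four
    constructor <;> simp only [hG] <;> linarith
  have hGd : ∀ s, HasDerivAt G (h s) s := fun s => by
    have h1 := (Real.hasDerivAt_arcsin (hne s).1 (hne s).2).comp s
      ((Real.hasDerivAt_sin s).const_mul c)
    refine h1.congr_deriv ?_
    have h2 : 1 - (c * Real.sin s) ^ 2 = (p + Real.cos s ^ 2) / (1 + p) := by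
      rw [mul_pow, hc2]
      have := Real.sin_sq_add_cos_sq s
      field_simp
      linarith
    rw [h2, Real.sqrt_div (hpos s).le]
    have := Real.sqrt_pos.2 (hpos s)
    simp only [hh, hc]
    field_simp
  have hHd : ∀ s, HasDerivAt (fun s => ∫ x in (0 : ℝ)..s, G x) (G s) s := fun s =>
    intervalIntegral.integral_hasDerivAt_right (hGs.continuous.intervalIntegrable _ _)
      (hGs.continuous.stronglyMeasurableAtFilter _ _) hGs.continuous.continuousAt
  refine ⟨fun s => ∫ x in (0 : ℝ)..s, G x, G, h, ?_, hGs, ?_, hHd, hGd, hGb, ?_, ?_, ?_⟩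
  · rw [contDiff_infty_iff_deriv]
    refine ⟨fun s => (hHd s).differentiableAt, ?_⟩
    rwa [show deriv (fun s => ∫ x in (0 : ℝ)..s, G x) = G from funext fun s => (hHd s).deriv]
  · exact Real.continuous_cos.div (by fun_prop) fun s => (Real.sqrt_pos.2 (hpos s)).ne'
  · intro s
    have := intervalIntegral.norm_integral_le_of_norm_le_const (a := (0 : ℝ)) (b := s) (f := G)
      (C := 2) fun x _ => hGb x
    simpa using this
  · intro s
    simp only [hh]
    rw [abs_div, abs_of_pos (Real.sqrt_pos.2 (hpos s)), div_le_one (Real.sqrt_pos.2 (hpos s))]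
    exact Real.abs_le_sqrt (by linarith)
  · intro s hs
    have hS := Real.sqrt_pos.2 (hpos s)
    have hSS := Real.sq_sqrt (hpos s).le
    simp only [hh]
    rw [abs_div, abs_of_pos hS, le_div_iff₀ hS]
    have hle : |Real.cos s| ≤ √(p + Real.cos s ^ 2) := Real.abs_le_sqrt (by linarith)
    have hk : κ ^ 2 ≤ Real.cos s ^ 2 := by
      rw [← sq_abs (Real.cos s)]; gcongr
    have habs2 := sq_abs (Real.cos s)
    have hmul : δ * κ ^ 2 ≤ δ * √(p + Real.cos s ^ 2) ^ 2 := by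
      rw [hSS]; gcongr; linarith
    nlinarith [mul_nonneg (sub_nonneg.2 hle) (abs_nonneg (Real.cos s))]

theorem exists_norm_fderiv_le {E F : Type*} [NormedAddCommGroup E] [NormedSpace ℝ E]
    [NormedAddCommGroup F] [NormedSpace ℝ F] {f : E → F} (hf : ContDiff ℝ (⊤ : ℕ∞) f)
    (hc : HasCompactSupport f) : ∃ C, ∀ y, ‖fderiv ℝ f y‖ ≤ C :=
  (hf.continuous_fderiv (by norm_num)).bounded_above_of_compact_support (hc.fderiv ℝ)

/-- The field `(∂ₙψ) a - (∂ₐψ) n` of a stream function `ψ = η K`, where `K` varies only in the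
direction `n`, is divergence-free; if `K` oscillates fast, its gradient is close to a multiple
of `a ⊗ n`. -/
theorem exists_oscillating_field {d : ℕ} {η : EuclideanSpace ℝ (Fin d) → ℝ}
    (hη : ContDiff ℝ (⊤ : ℕ∞) η) (hηc : HasCompactSupport η) {a n : EuclideanSpace ℝ (Fin d)}
    (han : inner ℝ n a = 0) (hnn : ‖n‖ = 1) (haa : ‖a‖ = 1) {H G h : ℝ → ℝ}
    (hHs : ContDiff ℝ (⊤ : ℕ∞) H) (hGs : ContDiff ℝ (⊤ : ℕ∞) G)
    (hHd : ∀ s, HasDerivAt H (G s) s) (hGd : ∀ s, HasDerivAt G (h s) s) (hGb : ∀ s, |G s| ≤ 2)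
    (hHb : ∀ s, |H s| ≤ 2 * |s|) (t : ℝ) {δ : ℝ} (hδ : 0 < δ) :
    ∃ m : ℝ, ∀ τ ∈ Set.Icc (0 : ℝ) 1,
      ∃ φ : EuclideanSpace ℝ (Fin d) → EuclideanSpace ℝ (Fin d),
        ContDiff ℝ (⊤ : ℕ∞) φ ∧ tsupport φ ⊆ tsupport η ∧ (∀ y, (jac φ y).trace = 0) ∧
        ∀ y i j, |jac φ y i j - t * (η y * h (m * inner ℝ n y + τ)) * (a i * n j)| < δ := by
  have hη1s : ContDiff ℝ (⊤ : ℕ∞) (fderiv ℝ η) := hη.fderiv_right (by norm_cast)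
  obtain ⟨M0, hM0⟩ := hη.continuous.bounded_above_of_compact_support hηc
  obtain ⟨M1, hM1⟩ := exists_norm_fderiv_le hη hηc
  obtain ⟨M2, hM2⟩ := exists_norm_fderiv_le hη1s (hηc.fderiv ℝ)
  obtain ⟨R, hR⟩ := hηc.isCompact.isBounded.exists_norm_le
  set M : ℝ := max M0 (max M1 M2) with hM
  have hM0' : ∀ y, |η y| ≤ M := fun y => (hM0 y).trans (le_max_left _ _)
  have hM1' : ∀ y, ‖fderiv ℝ η y‖ ≤ M := fun y =>
    (hM1 y).trans ((le_max_left _ _).trans (le_max_right _ _))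
  have hM2' : ∀ y, ‖fderiv ℝ (fderiv ℝ η) y‖ ≤ M := fun y =>
    (hM2 y).trans ((le_max_right _ _).trans (le_max_right _ _))
  have hMn : 0 ≤ M := (abs_nonneg _).trans (hM0' 0)
  set P : ℝ := 2 * (|R| + 1) with hP
  have hP2 : 2 ≤ P := by have := abs_nonneg R; linarith
  set C : ℝ := |t| * (5 * (M * P)) with hC
  have hCn : 0 ≤ C := by positivity
  set m : ℝ := 1 + C / δ with hm
  have hm1 : 1 ≤ m := by have : 0 ≤ C / δ := by positivity
                         linarith
  have hm0 : 0 < m := by linarith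
  have hCm : C / m < δ := by
    rw [div_lt_iff₀ hm0, hm, mul_add, mul_div_cancel₀ _ hδ.ne']; linarith
  refine ⟨m, fun τ hτ => ?_⟩
  set l : EuclideanSpace ℝ (Fin d) → ℝ := fun y => m * inner ℝ n y + τ with hl
  set K : EuclideanSpace ℝ (Fin d) → ℝ := fun y => H (l y) / m ^ 2 with hK
  set L : EuclideanSpace ℝ (Fin d) → ℝ := fun y => G (l y) / m with hL
  have hld : ∀ y, HasFDerivAt l (m • innerSL ℝ n) y := fun y =>
    (((innerSL ℝ n).hasFDerivAt (x := y)).const_mul m).add_const τ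
  have hls : ContDiff ℝ (⊤ : ℕ∞) l := by
    exact (contDiff_const.mul (contDiff_const.inner ℝ contDiff_id)).add contDiff_const
  have hKd : ∀ y, HasFDerivAt K (L y • innerSL ℝ n) y := fun y => by
    have := ((hHd (l y)).comp_hasFDerivAt y (hld y)).mul_const (m ^ 2)⁻¹
    refine (this.congr_fderiv ?_)
    rw [smul_smul, smul_smul]
    congr 1
    simp only [hL]
    field_simp
  have hLd : ∀ y, HasFDerivAt L (h (l y) • innerSL ℝ n) y := fun y => by
    have := ((hGd (l y)).comp_hasFDerivAt y (hld y)).mul_const m⁻¹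
    refine (this.congr_fderiv ?_)
    rw [smul_smul, smul_smul]
    congr 1
    field_simp
  have hKs : ContDiff ℝ (⊤ : ℕ∞) K := (hHs.comp hls).div_const _
  have hLs : ContDiff ℝ (⊤ : ℕ∞) L := (hGs.comp hls).div_const _
  have hLb : ∀ y, |L y| ≤ P / m := fun y => by
    simp only [hL]
    rw [abs_div, abs_of_pos hm0]
    gcongr
    exact (hGb _).trans hP2
  have hKb : ∀ y ∈ tsupport η, |K y| ≤ P / m := fun y hy => by
    simp only [hK]
    rw [abs_div, abs_of_pos (by positivity : 0 < m ^ 2), div_le_div_iff₀ (by positivity) hm0]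
    have h1 : |inner ℝ n y| ≤ |R| := by
      refine (abs_real_inner_le_norm n y).trans ?_
      rw [hnn, one_mul]
      exact (hR y hy).trans (le_abs_self R)
    have h2 : |l y| ≤ m * (|R| + 1) := by
      calc |l y| ≤ |m * inner ℝ n y| + |τ| := abs_add_le _ _
        _ ≤ m * |R| + 1 := by
            rw [abs_mul, abs_of_pos hm0, abs_of_nonneg hτ.1]
            gcongr
            exact hτ.2
        _ ≤ _ := by linarith
    calc |H (l y)| * m ≤ (2 * (m * (|R| + 1))) * m := by
          gcongr
          exact (hHb _).trans (by gcongr)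
      _ = P * m ^ 2 := by rw [hP]; ring
  have hηd : ∀ y, HasFDerivAt η (fderiv ℝ η y) y := fun y =>
    (hη.differentiable (by norm_num) y).hasFDerivAt
  have hη1d : ∀ (v y : EuclideanSpace ℝ (Fin d)), HasFDerivAt (fun y => fderiv ℝ η y v)
      ((ContinuousLinearMap.apply ℝ ℝ v).comp (fderiv ℝ (fderiv ℝ η) y)) y := fun v y =>
    (ContinuousLinearMap.apply ℝ ℝ v).hasFDerivAt.comp y
      (hη1s.differentiable (by norm_num) y).hasFDerivAt
  have hηv : ∀ v : EuclideanSpace ℝ (Fin d), ContDiff ℝ (⊤ : ℕ∞) fun y => fderiv ℝ η y v :=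
    fun v => hη1s.clm_apply contDiff_const
  set u : EuclideanSpace ℝ (Fin d) → ℝ := fun y => η y * L y + fderiv ℝ η y n * K y with hu
  set w : EuclideanSpace ℝ (Fin d) → ℝ := fun y => fderiv ℝ η y a * K y with hw
  have hus : ContDiff ℝ (⊤ : ℕ∞) u := (hη.mul hLs).add ((hηv n).mul hKs)
  have hws : ContDiff ℝ (⊤ : ℕ∞) w := (hηv a).mul hKs
  set Du : EuclideanSpace ℝ (Fin d) → EuclideanSpace ℝ (Fin d) → ℝ := fun y v =>
    fderiv ℝ η y v * L y + η y * (h (l y) * inner ℝ n v) +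
      (fderiv ℝ (fderiv ℝ η) y v n * K y + fderiv ℝ η y n * (L y * inner ℝ n v)) with hDu
  set Dw : EuclideanSpace ℝ (Fin d) → EuclideanSpace ℝ (Fin d) → ℝ := fun y v =>
    fderiv ℝ (fderiv ℝ η) y v a * K y + fderiv ℝ η y a * (L y * inner ℝ n v) with hDw
  have hud : ∀ y v, fderiv ℝ u y v = Du y v := fun y v => by
    have h1 : HasFDerivAt u _ y := ((hηd y).mul (hLd y)).add ((hη1d n y).mul (hKd y))
    rw [h1.fderiv]
    simp [hDu]
    ring
  have hwd : ∀ y v, fderiv ℝ w y v = Dw y v := fun y v => by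
    have h1 : HasFDerivAt w _ y := (hη1d a y).mul (hKd y)
    rw [h1.fderiv]
    simp [hDw]
    ring
  have hjac : ∀ y i j, jac (fun y => (t * u y) • a - (t * w y) • n) y i j =
      t * Du y (EuclideanSpace.single j 1) * a i - t * Dw y (EuclideanSpace.single j 1) * n i := by
    intro y i j
    have h1 := ((hus.differentiable (by norm_num) y).hasFDerivAt.const_mul t).smul_const a
    have h2 := ((hws.differentiable (by norm_num) y).hasFDerivAt.const_mul t).smul_const n
    have h3 : HasFDerivAt (fun y => (t * u y) • a - (t * w y) • n) _ y := h1.sub h2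
    rw [jac, h3.fderiv]
    simp [hud, hwd]
  have hcoord : ∀ (v : EuclideanSpace ℝ (Fin d)),
      ∑ i, v i • (EuclideanSpace.single i (1 : ℝ) : EuclideanSpace ℝ (Fin d)) = v := fun v => by
    ext k
    simp [Finset.sum_apply, Pi.single_apply]
  refine ⟨fun y => (t * u y) • a - (t * w y) • n, ?_, ?_, ?_, ?_⟩
  · exact ((contDiff_const.mul hus).smul contDiff_const).sub
      ((contDiff_const.mul hws).smul contDiff_const)
  · refine closure_minimal (fun y hy => ?_) (isClosed_tsupport η)
    by_contra hny
    have h0 : η y = 0 := image_eq_zero_of_notMem_tsupport hny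
    have h1 : fderiv ℝ η y = 0 := by
      by_contra h
      exact hny (support_fderiv_subset ℝ h)
    exact hy (by simp [hu, hw, h0, h1])
  · intro y
    have h2 : (2 : WithTop ℕ∞) ≤ ((⊤ : ℕ∞) : WithTop ℕ∞) :=
      WithTop.coe_le_coe.2 (le_top : (2 : ℕ∞) ≤ ⊤)
    have hsymm : fderiv ℝ (fderiv ℝ η) y a n = fderiv ℝ (fderiv ℝ η) y n a :=
      (hη.contDiffAt.isSymmSndFDerivAt (by simpa using h2)) a n
    have hDuL : ∀ v : EuclideanSpace ℝ (Fin d),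
        ∑ i, Du y (EuclideanSpace.single i 1) * v i = Du y v := fun v => by
      conv_rhs => rw [← hud, ← hcoord v, map_sum]
      exact Finset.sum_congr rfl fun i _ => by rw [map_smul, hud, smul_eq_mul, mul_comm]
    have hDwL : ∀ v : EuclideanSpace ℝ (Fin d),
        ∑ i, Dw y (EuclideanSpace.single i 1) * v i = Dw y v := fun v => by
      conv_rhs => rw [← hwd, ← hcoord v, map_sum]
      exact Finset.sum_congr rfl fun i _ => by rw [map_smul, hwd, smul_eq_mul, mul_comm]
    have : (jac (fun y => (t * u y) • a - (t * w y) • n) y).trace = t * Du y a - t * Dw y n := by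
      rw [← hDuL a, ← hDwL n, Finset.mul_sum, Finset.mul_sum, ← Finset.sum_sub_distrib]
      exact Finset.sum_congr rfl fun i _ => by rw [Matrix.diag_apply, hjac]; ring
    rw [this]
    simp only [hDu, hDw, han, real_inner_self_eq_norm_sq, hnn, hsymm]
    ring
  · intro y i j
    refine lt_of_le_of_lt ?_ hCm
    set e : EuclideanSpace ℝ (Fin d) := EuclideanSpace.single j 1 with he
    have hin : inner ℝ n e = n j := by rw [he, EuclideanSpace.inner_single_right]; simp
    have hcb : ∀ (v : EuclideanSpace ℝ (Fin d)) k, ‖v‖ = 1 → |v k| ≤ 1 := fun v k hv => by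
      have := PiLp.norm_apply_le v k
      rwa [hv] at this
    have hen : ‖e‖ = 1 := by simp [he]
    have hA : ∀ v : EuclideanSpace ℝ (Fin d), ‖v‖ = 1 → |fderiv ℝ η y v| ≤ M := fun v hv => by
      have := (fderiv ℝ η y).le_opNorm v
      rw [hv, mul_one] at this
      exact this.trans (hM1' y)
    have hMP : 0 ≤ M * P / m := div_nonneg (mul_nonneg hMn (by linarith)) hm0.le
    have hB : ∀ v : EuclideanSpace ℝ (Fin d), ‖v‖ = 1 →
        |fderiv ℝ (fderiv ℝ η) y e v * K y| ≤ M * P / m := fun v hv => by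
      by_cases hy : y ∈ tsupport η
      · rw [abs_mul, mul_div_assoc]
        have h1 := (fderiv ℝ (fderiv ℝ η) y e).le_opNorm v
        have h2 := (fderiv ℝ (fderiv ℝ η) y).le_opNorm e
        rw [hv, mul_one] at h1
        rw [hen, mul_one] at h2
        exact mul_le_mul (h1.trans (h2.trans (hM2' y))) (hKb y hy) (abs_nonneg _) hMn
      · have : fderiv ℝ (fderiv ℝ η) y = 0 := by
          by_contra h
          exact hy (tsupport_fderiv_subset ℝ (support_fderiv_subset ℝ h))
        rw [this]
        simpa using hMP
    have hLc : ∀ x c : ℝ, |x| ≤ M → |c| ≤ 1 → |x * (L y * c)| ≤ M * P / m := fun x c hx hc => by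
      rw [abs_mul, abs_mul, mul_div_assoc]
      have : |L y| * |c| ≤ P / m * 1 := mul_le_mul (hLb y) hc (abs_nonneg _) (by positivity)
      rw [mul_one] at this
      exact mul_le_mul hx this (by positivity) hMn
    have h1 := hLc _ 1 (hA e hen) (by simp)
    have h2 := hB n hnn
    have h3 := hLc _ (n j) (hA n hnn) (hcb n j hnn)
    have h4 := hB a haa
    have h5 := hLc _ (n j) (hA a haa) (hcb n j hnn)
    have hfin : ∀ x c : ℝ, |c| ≤ 1 → |x| ≤ M * P / m → |x * c| ≤ M * P / m :=
      fun x c hc hx => by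
        rw [abs_mul]
        nlinarith [abs_nonneg x, abs_nonneg c]
    have k1 := hfin _ (a i) (hcb a i haa) h1
    have k2 := hfin _ (a i) (hcb a i haa) h2
    have k3 := hfin _ (a i) (hcb a i haa) h3
    have k4 := hfin _ (n i) (hcb n i hnn) h4
    have k5 := hfin _ (n i) (hcb n i hnn) h5
    rw [hjac]
    have hexp : t * Du y e * a i - t * Dw y e * n i -
        t * (η y * h (m * inner ℝ n y + τ)) * (a i * n j) =
        t * (fderiv ℝ η y e * (L y * 1) * a i + fderiv ℝ (fderiv ℝ η) y e n * K y * a i +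
          fderiv ℝ η y n * (L y * n j) * a i - fderiv ℝ (fderiv ℝ η) y e a * K y * n i -
          fderiv ℝ η y a * (L y * n j) * n i) := by
      simp only [hDu, hDw, hin, hl]
      ring
    rw [hexp, abs_mul, hC, mul_div_assoc]
    gcongr
    rw [abs_le] at k1 k2 k3 k4 k5 ⊢
    have : 5 * (M * P) / m = 5 * (M * P / m) := by ring
    rw [this]
    constructor <;> linarith [k1.1, k1.2, k2.1, k2.2, k3.1, k3.2, k4.1, k4.2, k5.1, k5.2]

theorem continuous_jac {d : ℕ} {φ : EuclideanSpace ℝ (Fin d) → EuclideanSpace ℝ (Fin d)}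
    (hφ : ContDiff ℝ (⊤ : ℕ∞) φ) (i j : Fin d) : Continuous fun y => jac φ y i j :=
  (EuclideanSpace.proj (𝕜 := ℝ) i).continuous.comp
    ((hφ.continuous_fderiv (by norm_num)).clm_apply continuous_const)

/-- Smooth divergence-free fields with compact support in `U`. -/
structure IsTestField {d : ℕ} (U : Set (EuclideanSpace ℝ (Fin d)))
    (φ : EuclideanSpace ℝ (Fin d) → EuclideanSpace ℝ (Fin d)) : Prop where
  contDiff : ContDiff ℝ (⊤ : ℕ∞) φ
  hasCompactSupport : HasCompactSupport φ
  tsupport_subset : tsupport φ ⊆ U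
  trace_jac : ∀ y, (jac φ y).trace = 0

theorem exists_smooth_cutoff {d : ℕ} {U : Set (EuclideanSpace ℝ (Fin d))} (hU : IsOpen U)
    (hUb : volume U ≠ ⊤) {ε : ENNReal} (hε : ε ≠ 0) :
    ∃ (η : EuclideanSpace ℝ (Fin d) → ℝ) (K : Set (EuclideanSpace ℝ (Fin d))),
      ContDiff ℝ (⊤ : ℕ∞) η ∧ HasCompactSupport η ∧ tsupport η ⊆ U ∧
      (∀ y, η y ∈ Set.Icc (0 : ℝ) 1) ∧ (∀ y ∈ K, η y = 1) ∧ volume (U \ K) < ε := by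
  obtain ⟨K, hKU, hK, hKε⟩ := hU.measurableSet.exists_isCompact_sdiff_lt hUb hε
  obtain ⟨L, hL, hKL, hLU⟩ := exists_compact_between hK hU hKU
  obtain ⟨η, hη, hηr, hηs, hη1⟩ := exists_contMDiff_support_eq_eq_one_iff
    (n := (⊤ : ℕ∞)) (modelWithCornersSelf ℝ (EuclideanSpace ℝ (Fin d)))
    isOpen_interior hK.isClosed hKL
  have hts : tsupport η ⊆ L :=
    closure_minimal (hηs.trans_subset interior_subset) hL.isClosed
  exact ⟨η, K, hη.contDiff, HasCompactSupport.of_support_subset_isCompact hL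
    (hηs.trans_subset interior_subset), hts.trans hLU, fun y => hηr ⟨y, rfl⟩,
    fun y hy => (hη1 y).1 hy, hKε⟩

/-- Among finitely many well-separated phase shifts, one makes the set where
`cos (l y + τ)` is small have small measure. -/
theorem exists_phase {X : Type*} [MeasurableSpace X] {μ : Measure X} {U : Set X}
    (hUm : MeasurableSet U) (hU : μ U ≠ ⊤) {ε : ENNReal} (hε : ε ≠ 0) :
    ∃ κ : ℝ, 0 < κ ∧ ∀ l : X → ℝ, Measurable l →
      ∃ τ ∈ Set.Icc (0 : ℝ) 1, μ {y ∈ U | |Real.cos (l y + τ)| < κ} ≤ ε := by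
  obtain ⟨N, hN⟩ := ENNReal.exists_nat_mul_gt hε hU
  have hN0 : 0 < N := by
    rcases Nat.eq_zero_or_pos N with h | h
    · simp [h] at hN
    · exact h
  have hNr : (0 : ℝ) < N := by exact_mod_cast hN0
  have hN1 : (1 : ℝ) ≤ N := by exact_mod_cast hN0
  have hinv : 1 / (N : ℝ) ≤ 1 := by rw [div_le_one hNr]; exact hN1
  have hpi := Real.pi_gt_three
  have hs0 : 0 < Real.sin (1 / N) :=
    Real.sin_pos_of_pos_of_lt_pi (by positivity) (by linarith)
  refine ⟨Real.sin (1 / N) / 2, by positivity, fun l hl => ?_⟩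
  by_contra! hcon
  set B : ℕ → Set X := fun k => {y ∈ U | |Real.cos (l y + k / N)| < Real.sin (1 / N) / 2}
    with hB
  have hBm : ∀ k, MeasurableSet (B k) := fun k =>
    hUm.inter (measurableSet_lt ((Real.measurable_cos.comp (hl.add_const _)).abs)
      measurable_const)
  have hsep : ∀ j k : ℕ, j < k → k < N → Disjoint (B j) (B k) := fun j k hjk hkN => by
    rw [Set.disjoint_left]
    rintro y ⟨-, h1⟩ ⟨-, h2⟩
    have hjk' : (j : ℝ) + 1 ≤ k := by exact_mod_cast hjk
    have hkN' : (k : ℝ) < N := by exact_mod_cast hkN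
    have hd1 : 1 / (N : ℝ) ≤ k / N - j / N := by
      rw [← sub_div]; gcongr; linarith
    have hd2 : (k : ℝ) / N - j / N ≤ 1 := by
      rw [← sub_div, div_le_one hNr]
      have : (0 : ℝ) ≤ j := by positivity
      linarith
    have hmono : Real.sin (1 / N) ≤ Real.sin (k / N - j / N) :=
      Real.sin_le_sin_of_le_of_le_pi_div_two
        (by have : (0 : ℝ) ≤ 1 / N := by positivity
            linarith) (by linarith) hd1
    have hsin : Real.sin (k / N - j / N) =
        Real.sin (l y + k / N) * Real.cos (l y + j / N) -
          Real.cos (l y + k / N) * Real.sin (l y + j / N) := by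
      rw [← Real.sin_sub]; congr 1; ring
    have hle : |Real.sin (k / N - j / N)| ≤
        |Real.cos (l y + j / N)| + |Real.cos (l y + k / N)| := by
      rw [hsin]
      refine (abs_sub _ _).trans ?_
      rw [abs_mul, abs_mul]
      have a1 := Real.abs_sin_le_one (l y + k / N)
      have a2 := Real.abs_sin_le_one (l y + j / N)
      nlinarith [abs_nonneg (Real.cos (l y + j / N)), abs_nonneg (Real.cos (l y + k / N))]
    have := le_abs_self (Real.sin (k / N - j / N))
    linarith
  have hdisj : Set.PairwiseDisjoint (↑(Finset.range N)) B := fun j hj k hk hjk => by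
    simp only [Finset.coe_range, Set.mem_Iio] at hj hk
    rcases lt_or_gt_of_ne hjk with h | h
    · exact hsep j k h hk
    · exact (hsep k j h hj).symm
  have hsum := measure_biUnion_finset (μ := μ) hdisj fun k _ => hBm k
  have hle : μ (⋃ k ∈ Finset.range N, B k) ≤ μ U :=
    measure_mono (Set.iUnion₂_subset fun k _ y hy => hy.1)
  have hge : (N : ENNReal) * ε ≤ ∑ k ∈ Finset.range N, μ (B k) := by
    rw [← nsmul_eq_mul, show N • ε = ∑ _k ∈ Finset.range N, ε by simp]
    refine Finset.sum_le_sum fun k hk => (hcon (k / N) ⟨by positivity, ?_⟩).le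
    rw [div_le_one hNr]
    exact_mod_cast (Finset.mem_range.1 hk).le
  exact absurd (hge.trans (hsum ▸ hle)) (not_le.2 hN)

theorem isOpen_setOf_jac_near {d : ℕ} {φ : EuclideanSpace ℝ (Fin d) → EuclideanSpace ℝ (Fin d)}
    (hφ : ContDiff ℝ (⊤ : ℕ∞) φ) (A : Matrix (Fin d) (Fin d) ℝ) (δ : ℝ) :
    IsOpen {y | ∀ i j, |jac φ y i j - A i j| < δ} := by
  simp only [Set.ofPred_forall]
  exact isOpen_iInter_of_finite fun i => isOpen_iInter_of_finite fun j =>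
    isOpen_lt ((continuous_jac hφ i j).sub continuous_const).abs continuous_const

/-- A divergence-free field whose gradient is close to `± t a ⊗ n` on two disjoint open sets that
exhaust `U` up to small measure. -/
theorem exists_two_phase_field {d : ℕ} {a n : EuclideanSpace ℝ (Fin d)}
    (han : inner ℝ n a = 0) (hnn : ‖n‖ = 1) (haa : ‖a‖ = 1) (t : ℝ)
    {U : Set (EuclideanSpace ℝ (Fin d))} (hU : IsOpen U) (hUb : volume U ≠ ⊤)
    {ε : ENNReal} (hε : ε ≠ 0) {δ : ℝ} (hδ : 0 < δ) :
    ∃ (φ : EuclideanSpace ℝ (Fin d) → EuclideanSpace ℝ (Fin d))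
      (U₁ U₂ : Set (EuclideanSpace ℝ (Fin d))),
      IsTestField U φ ∧ IsOpen U₁ ∧ IsOpen U₂ ∧ U₁ ⊆ U ∧ U₂ ⊆ U ∧ Disjoint U₁ U₂ ∧
      volume (U \ (U₁ ∪ U₂)) ≤ ε ∧ (∀ y i j, |jac φ y i j| ≤ |t| + δ) ∧
      (∀ y ∈ U₁, ∀ i j, |jac φ y i j - t * (a i * n j)| < δ) ∧
      (∀ y ∈ U₂, ∀ i j, |jac φ y i j - -t * (a i * n j)| < δ) := by
  have hε2 : ε / 2 ≠ 0 := by simpa using hε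
  obtain ⟨η, K, hη, hηc, hηU, hη01, hηK, hKε⟩ := exists_smooth_cutoff hU hUb hε2
  obtain ⟨κ, hκ, hphase⟩ := exists_phase hU.measurableSet hUb hε2
  have hδ' : 0 < min (1 / 2) (δ / (2 * (|t| + 1))) := by positivity
  obtain ⟨H, G, h, hHs, hGs, hhc, hHd, hGd, hGb, hHb, hhb, hhκ⟩ :=
    exists_smoothed_square_wave hκ hδ'
  obtain ⟨m, hm⟩ := exists_oscillating_field hη hηc han hnn haa hHs hGs hHd hGd hGb hHb t
    (half_pos hδ)
  obtain ⟨τ, hτ, hτε⟩ := hphase (fun y => m * inner ℝ n y)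
    (measurable_const.mul (continuous_const.inner continuous_id).measurable)
  obtain ⟨φ, hφ, hφη, hφ0, hφe⟩ := hm τ hτ
  have hcb : ∀ (v : EuclideanSpace ℝ (Fin d)) k, ‖v‖ = 1 → |v k| ≤ 1 := fun v k hv => by
    have := PiLp.norm_apply_le v k
    rwa [hv] at this
  have hanb : ∀ i j, |a i * n j| ≤ 1 := fun i j => by
    rw [abs_mul]
    exact mul_le_one₀ (hcb a i haa) (abs_nonneg _) (hcb n j hnn)
  have hlc : Continuous fun y : EuclideanSpace ℝ (Fin d) => h (m * inner ℝ n y + τ) :=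
    hhc.comp ((continuous_const.mul (continuous_const.inner continuous_id)).add continuous_const)
  have hnear : ∀ y s i j, η y = 1 → |h (m * inner ℝ n y + τ) - s| ≤ δ / (2 * (|t| + 1)) →
      |jac φ y i j - s * t * (a i * n j)| < δ := fun y s i j hy hs => by
    have h1 := hφe y i j
    rw [hy, one_mul] at h1
    have h2 : |(t * h (m * inner ℝ n y + τ)) * (a i * n j) - s * t * (a i * n j)| ≤ δ / 2 := by
      rw [show (t * h (m * inner ℝ n y + τ)) * (a i * n j) - s * t * (a i * n j) =
        t * (h (m * inner ℝ n y + τ) - s) * (a i * n j) by ring, abs_mul, abs_mul]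
      calc |t| * |h (m * inner ℝ n y + τ) - s| * |a i * n j|
          ≤ (|t| + 1) * (δ / (2 * (|t| + 1))) * 1 := by
            gcongr
            · linarith
            · exact hanb i j
        _ = δ / 2 := by field_simp
    calc |jac φ y i j - s * t * (a i * n j)| ≤ _ := abs_sub_le _ _ _
      _ < δ := by linarith
  refine ⟨φ, {y ∈ U | 0 < h (m * inner ℝ n y + τ)} ∩
      {y | ∀ i j, |jac φ y i j - (Matrix.of fun i j => t * (a i * n j)) i j| < δ},
    {y ∈ U | h (m * inner ℝ n y + τ) < 0} ∩
      {y | ∀ i j, |jac φ y i j - (Matrix.of fun i j => -t * (a i * n j)) i j| < δ},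
    ⟨hφ, hηc.mono' ((subset_tsupport φ).trans hφη), hφη.trans hηU, hφ0⟩,
    (hU.inter (isOpen_lt continuous_const hlc)).inter (isOpen_setOf_jac_near hφ _ δ),
    (hU.inter (isOpen_lt hlc continuous_const)).inter (isOpen_setOf_jac_near hφ _ δ),
    fun y hy => hy.1.1, fun y hy => hy.1.1,
    Set.disjoint_left.2 fun y hy1 hy2 => lt_asymm hy1.1.2 hy2.1.2, ?_, ?_,
    fun y hy => hy.2, fun y hy => hy.2⟩
  · calc _ ≤ volume ((U \ K) ∪ {y ∈ U | |Real.cos (m * inner ℝ n y + τ)| < κ}) := by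
          refine measure_mono fun y hy => ?_
          by_contra hcon
          simp only [Set.mem_union, Set.mem_sdiff, Set.mem_ofPred_eq, not_or, not_and, not_not,
            not_lt] at hcon
          have hyU := hy.1
          have hyη := hηK y (hcon.1 hyU)
          have hhy := hhκ _ (hcon.2 hyU)
          have hmin := min_le_right (1 / 2) (δ / (2 * (|t| + 1)))
          have hb := abs_le.1 (hhb (m * inner ℝ n y + τ))
          refine hy.2 ?_
          rcases lt_trichotomy (h (m * inner ℝ n y + τ)) 0 with hneg | hzero | hpos
          · refine Or.inr ⟨⟨hyU, hneg⟩, fun i j => ?_⟩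
            rw [abs_of_neg hneg] at hhy
            have := hnear y (-1) i j hyη (by rw [abs_le]; constructor <;> linarith)
            simpa using this
          · exfalso
            rw [hzero, abs_zero] at hhy
            linarith [min_le_left (1 / 2) (δ / (2 * (|t| + 1)))]
          · refine Or.inl ⟨⟨hyU, hpos⟩, fun i j => ?_⟩
            rw [abs_of_pos hpos] at hhy
            have := hnear y 1 i j hyη (by rw [abs_le]; constructor <;> linarith)
            simpa using this
    _ ≤ ε / 2 + ε / 2 := (measure_union_le _ _).trans (add_le_add hKε.le hτε)
    _ = ε := ENNReal.add_halves ε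
  · intro y i j
    have h1 := hφe y i j
    have h2 : |t * (η y * h (m * inner ℝ n y + τ)) * (a i * n j)| ≤ |t| := by
      rw [abs_mul, abs_mul, abs_mul, abs_of_nonneg (hη01 y).1]
      calc |t| * (η y * |h (m * inner ℝ n y + τ)|) * |a i * n j| ≤ |t| * (1 * 1) * 1 := by
            gcongr
            · exact (hη01 y).2
            · exact hhb _
            · exact hanb i j
        _ = |t| := by ring
    have h3 := abs_sub_abs_le_abs_sub (jac φ y i j)
      (t * (η y * h (m * inner ℝ n y + τ)) * (a i * n j))
    linarith

theorem jac_add {d : ℕ} {φ ψ : EuclideanSpace ℝ (Fin d) → EuclideanSpace ℝ (Fin d)}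
    (hφ : ContDiff ℝ (⊤ : ℕ∞) φ) (hψ : ContDiff ℝ (⊤ : ℕ∞) ψ) (y : EuclideanSpace ℝ (Fin d)) :
    jac (φ + ψ) y = jac φ y + jac ψ y := by
  ext i j
  simp [jac, fderiv_add (hφ.differentiable (by norm_num) y) (hψ.differentiable (by norm_num) y)]

theorem jac_eq_zero_of_notMem_tsupport {d : ℕ}
    {φ : EuclideanSpace ℝ (Fin d) → EuclideanSpace ℝ (Fin d)} {y : EuclideanSpace ℝ (Fin d)}
    (hy : y ∉ tsupport φ) : jac φ y = 0 := by
  have h : fderiv ℝ φ y = 0 := by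
    by_contra h
    exact hy (support_fderiv_subset ℝ h)
  ext i j
  simp [jac, h]

theorem IsTestField.mono {d : ℕ} {U V : Set (EuclideanSpace ℝ (Fin d))}
    {φ : EuclideanSpace ℝ (Fin d) → EuclideanSpace ℝ (Fin d)} (h : IsTestField U φ) (hUV : U ⊆ V) :
    IsTestField V φ :=
  ⟨h.contDiff, h.hasCompactSupport, h.tsupport_subset.trans hUV, h.trace_jac⟩

theorem IsTestField.add {d : ℕ} {U : Set (EuclideanSpace ℝ (Fin d))}
    {φ ψ : EuclideanSpace ℝ (Fin d) → EuclideanSpace ℝ (Fin d)} (hφ : IsTestField U φ)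
    (hψ : IsTestField U ψ) : IsTestField U (φ + ψ) :=
  ⟨hφ.contDiff.add hψ.contDiff, hφ.hasCompactSupport.add hψ.hasCompactSupport,
    (tsupport_add φ ψ).trans (Set.union_subset hφ.tsupport_subset hψ.tsupport_subset),
    fun y => by
      rw [jac_add hφ.contDiff hψ.contDiff, Matrix.trace_add, hφ.trace_jac, hψ.trace_jac, add_zero]⟩

theorem IsTestField.zero {d : ℕ} (U : Set (EuclideanSpace ℝ (Fin d))) :
    IsTestField U (0 : EuclideanSpace ℝ (Fin d) → EuclideanSpace ℝ (Fin d)) := by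
  have hts : tsupport (0 : EuclideanSpace ℝ (Fin d) → EuclideanSpace ℝ (Fin d)) = ∅ :=
    tsupport_eq_empty_iff.2 rfl
  refine ⟨contDiff_const, HasCompactSupport.zero, by simp [hts], fun y => ?_⟩
  rw [jac_eq_zero_of_notMem_tsupport (by simp [hts]), Matrix.trace_zero]

/-- `Z` can be perturbed by gradients of uniformly Lipschitz divergence-free test fields so that
the perturbed gradient is close to `S` up to a set of small measure. -/
def IsReachable {d : ℕ} (S : Set (Matrix (Fin d) (Fin d) ℝ)) (Z : Matrix (Fin d) (Fin d) ℝ) :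
    Prop :=
  ∃ C : ℝ, 0 ≤ C ∧ ∀ U : Set (EuclideanSpace ℝ (Fin d)), IsOpen U → volume U ≠ ⊤ →
    ∀ ε : ENNReal, ε ≠ 0 → ∀ δ : ℝ, 0 < δ →
      ∃ (φ : EuclideanSpace ℝ (Fin d) → EuclideanSpace ℝ (Fin d))
        (V : Set (EuclideanSpace ℝ (Fin d))), IsTestField U φ ∧ IsOpen V ∧ V ⊆ U ∧
        volume (U \ V) ≤ ε ∧ (∀ y i j, |jac φ y i j| ≤ C) ∧
        ∀ y ∈ V, ∃ W ∈ S, ∀ i j, |Z i j + jac φ y i j - W i j| < δ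

theorem IsReachable.of_mem {d : ℕ} {S : Set (Matrix (Fin d) (Fin d) ℝ)}
    {Z : Matrix (Fin d) (Fin d) ℝ} (hZ : Z ∈ S) : IsReachable S Z := by
  have h0 : ∀ y, jac (0 : EuclideanSpace ℝ (Fin d) → EuclideanSpace ℝ (Fin d)) y = 0 := fun y =>
    jac_eq_zero_of_notMem_tsupport (by simp [tsupport_eq_empty_iff.2])
  exact ⟨0, le_rfl, fun U hU _ ε _ δ hδ => ⟨0, U, IsTestField.zero U, hU, subset_rfl, by simp,
    by simp [h0], fun y _ => ⟨Z, hZ, fun i j => by simpa [h0] using hδ⟩⟩⟩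

/-- Lamination: `Z` is reachable if it is the midpoint of two reachable matrices whose difference
is a trace-free rank-one matrix. -/
theorem IsReachable.laminate {d : ℕ} {S : Set (Matrix (Fin d) (Fin d) ℝ)}
    {Z : Matrix (Fin d) (Fin d) ℝ} {a n : EuclideanSpace ℝ (Fin d)}
    (han : inner ℝ n a = 0) (hnn : ‖n‖ = 1) (haa : ‖a‖ = 1) (t : ℝ)
    (h₁ : IsReachable S (Z + t • Matrix.vecMulVec a n))
    (h₂ : IsReachable S (Z + (-t) • Matrix.vecMulVec a n)) : IsReachable S Z := by
  obtain ⟨C₁, hC₁, h₁⟩ := h₁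
  obtain ⟨C₂, hC₂, h₂⟩ := h₂
  refine ⟨|t| + 1 + C₁ + C₂, by positivity, fun U hU hUb ε hε δ hδ => ?_⟩
  have hε3 : ε / 3 ≠ 0 := by simpa using hε
  have hδ2 := half_pos hδ
  have hδ1 : 0 < min (δ / 2) 1 := lt_min hδ2 one_pos
  obtain ⟨φ, U₁, U₂, hφ, hU₁, hU₂, hU₁U, hU₂U, hd, hUε, hφb, hφ₁, hφ₂⟩ :=
    exists_two_phase_field han hnn haa t hU hUb hε3 hδ1
  have hU₁b : volume U₁ ≠ ⊤ := ne_top_of_le_ne_top hUb (measure_mono hU₁U)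
  have hU₂b : volume U₂ ≠ ⊤ := ne_top_of_le_ne_top hUb (measure_mono hU₂U)
  obtain ⟨φ₁, V₁, hφ₁t, hV₁, hV₁U, hV₁ε, hφ₁b, hφ₁W⟩ := h₁ U₁ hU₁ hU₁b (ε / 3) hε3 (δ / 2) hδ2
  obtain ⟨φ₂, V₂, hφ₂t, hV₂, hV₂U, hV₂ε, hφ₂b, hφ₂W⟩ := h₂ U₂ hU₂ hU₂b (ε / 3) hε3 (δ / 2) hδ2
  have hjac : ∀ y, jac (φ + φ₁ + φ₂) y = jac φ y + jac φ₁ y + jac φ₂ y := fun y => by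
    rw [jac_add (φ := φ + φ₁) (hφ.contDiff.add hφ₁t.contDiff) hφ₂t.contDiff,
      jac_add hφ.contDiff hφ₁t.contDiff]
  have hnear : ∀ (x b e w v s : ℝ), |b - s * e| < min (δ / 2) 1 →
      |x + s * e + v - w| < δ / 2 → |x + (b + v) - w| < δ := fun x b e w v s h h' => by
    have h := h.trans_le (min_le_left _ _)
    rw [abs_lt] at h h' ⊢
    constructor <;> linarith [h.1, h.2, h'.1, h'.2]
  refine ⟨φ + φ₁ + φ₂, V₁ ∪ V₂, (hφ.add (hφ₁t.mono hU₁U)).add (hφ₂t.mono hU₂U), hV₁.union hV₂,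
    Set.union_subset (hV₁U.trans hU₁U) (hV₂U.trans hU₂U), ?_, ?_, ?_⟩
  · calc volume (U \ (V₁ ∪ V₂))
        ≤ volume ((U \ (U₁ ∪ U₂)) ∪ (U₁ \ V₁) ∪ (U₂ \ V₂)) := by
          refine measure_mono fun y hy => ?_
          simp only [Set.mem_union, Set.mem_sdiff] at hy ⊢
          tauto
      _ ≤ ε / 3 + ε / 3 + ε / 3 := (measure_union_le _ _).trans
          (add_le_add ((measure_union_le _ _).trans (add_le_add hUε hV₁ε)) hV₂ε)
      _ = ε := ENNReal.add_thirds ε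
  · intro y i j
    rw [hjac, Matrix.add_apply, Matrix.add_apply]
    have h0 := (hφb y i j).trans (add_le_add_right (min_le_right _ _) _)
    calc _ ≤ |jac φ y i j| + |jac φ₁ y i j| + |jac φ₂ y i j| := abs_add_three _ _ _
      _ ≤ _ := add_le_add (add_le_add h0 (hφ₁b y i j)) (hφ₂b y i j)
  · rintro y (hy | hy)
    · obtain ⟨W, hW, hWd⟩ := hφ₁W y hy
      refine ⟨W, hW, fun i j => ?_⟩
      have h2 : jac φ₂ y = 0 := jac_eq_zero_of_notMem_tsupport fun h =>
        Set.disjoint_left.1 hd (hV₁U hy) (hφ₂t.tsupport_subset h)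
      rw [hjac, h2, add_zero, Matrix.add_apply]
      exact hnear _ _ _ _ _ t (hφ₁ y (hV₁U hy) i j) (by
        simpa [Matrix.vecMulVec_apply] using hWd i j)
    · obtain ⟨W, hW, hWd⟩ := hφ₂W y hy
      refine ⟨W, hW, fun i j => ?_⟩
      have h2 : jac φ₁ y = 0 := jac_eq_zero_of_notMem_tsupport fun h =>
        Set.disjoint_left.1 hd (hφ₁t.tsupport_subset h) (hV₂U hy)
      rw [hjac, h2, add_zero, Matrix.add_apply]
      exact hnear _ _ _ _ _ (-t) (hφ₂ y (hV₂U hy) i j) (by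
        simpa [Matrix.vecMulVec_apply] using hWd i j)

/-- `x` lists the eigenvalues, with multiplicity and in some order, of the symmetric part
of `W`. -/
def HasSymSpectrum {d : ℕ} (W : Matrix (Fin d) (Fin d) ℝ) (x : Fin d → ℝ) : Prop :=
  ∃ Q : Matrix (Fin d) (Fin d) ℝ, Q * Qᵀ = 1 ∧ msym W = Q * diagonal x * Qᵀ

theorem mul_diagonal_mul_transpose_apply {d : ℕ} (Q : Matrix (Fin d) (Fin d) ℝ) (x : Fin d → ℝ)
    (i j : Fin d) : (Q * diagonal x * Qᵀ) i j = ∑ k, Q i k * x k * Q j k := by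
  rw [Matrix.mul_apply]
  simp [Matrix.mul_diagonal]

theorem HasSymSpectrum.comp_perm {d : ℕ} {W : Matrix (Fin d) (Fin d) ℝ} {x : Fin d → ℝ}
    (h : HasSymSpectrum W x) (σ : Equiv.Perm (Fin d)) : HasSymSpectrum W (x ∘ σ) := by
  obtain ⟨Q, hQ, hW⟩ := h
  refine ⟨Q.submatrix id σ, ?_, ?_⟩
  · rw [← hQ]
    ext i j
    simpa [Matrix.mul_apply] using Equiv.sum_comp σ fun k => Q i k * Q j k
  · rw [hW]
    ext i j
    rw [mul_diagonal_mul_transpose_apply, mul_diagonal_mul_transpose_apply,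
      ← Equiv.sum_comp σ fun k => Q i k * x k * Q j k]
    rfl

theorem HasSymSpectrum.rotate {W : Matrix (Fin 3) (Fin 3) ℝ} {x y z : ℝ}
    (h : HasSymSpectrum W ![x, y, z]) : HasSymSpectrum W ![y, z, x] := by
  have := h.comp_perm (finRotate 3)
  convert this using 1
  ext i
  fin_cases i <;> simp

theorem HasSymSpectrum.swap {W : Matrix (Fin 3) (Fin 3) ℝ} {x y z : ℝ}
    (h : HasSymSpectrum W ![x, y, z]) : HasSymSpectrum W ![y, x, z] := by
  have := h.comp_perm (Equiv.swap 0 1)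
  convert this using 1
  ext i
  fin_cases i <;> simp [Equiv.swap_apply_def]

theorem HasSymSpectrum.add_smul_vecMulVec {Z Q : Matrix (Fin 3) (Fin 3) ℝ} {x₀ x₁ x₂ : ℝ}
    (hQ : Q * Qᵀ = 1) (hZ : msym Z = Q * diagonal ![x₀, x₁, x₂] * Qᵀ) {c s p₀ p₁ : ℝ}
    (hcs : c ^ 2 + s ^ 2 = 1) (hx₀ : x₀ = c ^ 2 * p₀ + s ^ 2 * p₁)
    (hx₁ : x₁ = s ^ 2 * p₀ + c ^ 2 * p₁) :
    HasSymSpectrum (Z + (2 * (c * s * (p₀ - p₁))) •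
      Matrix.vecMulVec (fun i => Q i 0) (fun i => Q i 1)) ![p₀, p₁, x₂] := by
  set R : Matrix (Fin 3) (Fin 3) ℝ := !![c, -s, 0; s, c, 0; 0, 0, 1] with hR
  have hRR : R * Rᵀ = 1 := by
    ext i j
    fin_cases i <;> fin_cases j <;>
      simp [hR, Matrix.mul_apply, Fin.sum_univ_three] <;> first | ring1 | linear_combination hcs
  have hRD : R * diagonal ![p₀, p₁, x₂] * Rᵀ = diagonal ![x₀, x₁, x₂] +
      !![0, c * s * (p₀ - p₁), 0; c * s * (p₀ - p₁), 0, 0; 0, 0, 0] := by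
    ext i j
    rw [mul_diagonal_mul_transpose_apply, hx₀, hx₁]
    fin_cases i <;> fin_cases j <;> simp [hR, Fin.sum_univ_three] <;> ring
  refine ⟨Q * R, ?_, ?_⟩
  · rw [Matrix.transpose_mul, Matrix.mul_assoc, ← Matrix.mul_assoc R, hRR, Matrix.one_mul, hQ]
  · rw [Matrix.transpose_mul, show Q * R * diagonal ![p₀, p₁, x₂] * (Rᵀ * Qᵀ) =
      Q * (R * diagonal ![p₀, p₁, x₂] * Rᵀ) * Qᵀ by simp only [Matrix.mul_assoc], hRD,
      Matrix.mul_add, Matrix.add_mul, ← hZ]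
    ext i j
    simp [msym, Matrix.mul_apply, Fin.sum_univ_three, Matrix.vecMulVec_apply]
    ring

theorem isReachable_of_pair {S : Set (Matrix (Fin 3) (Fin 3) ℝ)} {x₀ x₁ x₂ p₀ p₁ : ℝ}
    (h₀ : p₀ ≤ x₀) (h₁ : x₀ ≤ p₁) (hsum : x₀ + x₁ = p₀ + p₁)
    (hS : ∀ W, HasSymSpectrum W ![p₀, p₁, x₂] → IsReachable S W)
    {Z : Matrix (Fin 3) (Fin 3) ℝ} (hZ : HasSymSpectrum Z ![x₀, x₁, x₂]) : IsReachable S Z := by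
  rcases eq_or_lt_of_le (h₀.trans h₁) with h | h
  · obtain rfl : p₀ = x₀ := by linarith
    obtain rfl : p₁ = x₁ := by linarith
    exact hS Z hZ
  obtain ⟨Q, hQ, hZ⟩ := hZ
  have hQ' : Qᵀ * Q = 1 := mul_eq_one_comm.1 hQ
  have hcol : ∀ k l, ∑ i, Q i k * Q i l = if k = l then 1 else 0 := fun k l => by
    have := congrFun (congrFun hQ' k) l
    rwa [Matrix.mul_apply, Matrix.one_apply] at this
  set θ : ℝ := (p₁ - x₀) / (p₁ - p₀) with hθ
  have hpp : 0 < p₁ - p₀ := sub_pos.2 h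
  have hθ0 : 0 ≤ θ := div_nonneg (by linarith) hpp.le
  have hθ1 : 0 ≤ 1 - θ := by
    rw [sub_nonneg, hθ, div_le_one hpp]; linarith
  have hc := Real.sq_sqrt hθ0
  have hs := Real.sq_sqrt hθ1
  have hθp : θ * (p₁ - p₀) = p₁ - x₀ := div_mul_cancel₀ _ hpp.ne'
  have hx₀ : x₀ = θ * p₀ + (1 - θ) * p₁ := by linarith
  have hx₁ : x₁ = (1 - θ) * p₀ + θ * p₁ := by linarith
  have hA := hS _ (HasSymSpectrum.add_smul_vecMulVec hQ hZ (c := √θ) (s := √(1 - θ)) (p₀ := p₀)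
    (p₁ := p₁) (by rw [hc, hs]; ring) (by rw [hc, hs]; exact hx₀) (by rw [hc, hs]; exact hx₁))
  have hB := hS _ (HasSymSpectrum.add_smul_vecMulVec hQ hZ (c := √θ) (s := -√(1 - θ)) (p₀ := p₀)
    (p₁ := p₁) (by rw [neg_sq, hc, hs]; ring) (by rw [neg_sq, hc, hs]; exact hx₀)
    (by rw [neg_sq, hc, hs]; exact hx₁))
  refine IsReachable.laminate (a := WithLp.toLp 2 fun i => Q i 0)
    (n := WithLp.toLp 2 fun i => Q i 1) ?_ ?_ ?_ (2 * (√θ * √(1 - θ) * (p₀ - p₁))) hA ?_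
  · simpa [PiLp.inner_apply] using hcol 0 1
  · rw [EuclideanSpace.norm_eq, Real.sqrt_eq_one]
    simpa [sq] using hcol 1 1
  · rw [EuclideanSpace.norm_eq, Real.sqrt_eq_one]
    simpa [sq] using hcol 0 0
  · rw [show -(2 * (√θ * √(1 - θ) * (p₀ - p₁))) = 2 * (√θ * -√(1 - θ) * (p₀ - p₁)) by ring]
    exact hB

/-- Two laminations spread a spectrum out to any trace-free spectrum majorizing it. -/
theorem isReachable_of_majorized {x₀ x₁ x₂ y₀ y₁ y₂ : ℝ} (hx₀₁ : x₀ ≤ x₁) (hx₁₂ : x₁ ≤ x₂)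
    (h₀ : y₀ ≤ x₀) (h₂ : x₂ ≤ y₂) (hsum : x₀ + x₁ + x₂ = y₀ + y₁ + y₂)
    {Z : Matrix (Fin 3) (Fin 3) ℝ} (hZ : HasSymSpectrum Z ![x₀, x₁, x₂]) :
    IsReachable {W | HasSymSpectrum W ![y₀, y₁, y₂]} Z := by
  have hZ' : HasSymSpectrum Z ![x₀, x₂, x₁] := hZ.rotate.rotate.swap
  rcases le_total (x₀ - y₀) (y₂ - x₂) with h | h
  · refine isReachable_of_pair (p₀ := y₀) (p₁ := x₂ + (x₀ - y₀)) h₀ (by linarith) (by ring)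
      (fun W hW => ?_) hZ'
    have hW' : HasSymSpectrum W ![x₁, x₂ + (x₀ - y₀), y₀] := hW.rotate.swap
    exact isReachable_of_pair (p₀ := y₁) (p₁ := y₂) (by linarith) (by linarith) (by linarith)
      (fun V hV => IsReachable.of_mem hV.rotate.rotate) hW'
  · refine isReachable_of_pair (p₀ := x₀ - (y₂ - x₂)) (p₁ := y₂) (by linarith) (by linarith)
      (by ring) (fun W hW => ?_) hZ'
    have hW' : HasSymSpectrum W ![x₀ - (y₂ - x₂), x₁, y₂] := hW.rotate.rotate.swap
    exact isReachable_of_pair (p₀ := y₀) (p₁ := y₁) (by linarith) (by linarith) (by linarith)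
      (fun V hV => IsReachable.of_mem hV) hW'

theorem isHermitian_msym {d : ℕ} (W : Matrix (Fin d) (Fin d) ℝ) : (msym W).IsHermitian := by
  rw [Matrix.IsHermitian, Matrix.conjTranspose_eq_transpose_of_trivial, msym,
    Matrix.transpose_smul, Matrix.transpose_add, Matrix.transpose_transpose, add_comm]

theorem monotone_sortedEig {d : ℕ} (A : Matrix (Fin d) (Fin d) ℝ) : Monotone (sortedEig A) := by
  unfold sortedEig
  split_ifs with hA
  · exact Tuple.monotone_sort hA.eigenvalues
  · exact monotone_const

theorem hasSymSpectrum_sortedEig {d : ℕ} (W : Matrix (Fin d) (Fin d) ℝ) :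
    HasSymSpectrum W (sortedEig (msym W)) := by
  have hW := isHermitian_msym W
  have h : HasSymSpectrum W hW.eigenvalues := by
    refine ⟨hW.eigenvectorUnitary, ?_, ?_⟩
    · have := Unitary.mul_star_self_of_mem hW.eigenvectorUnitary.2
      rwa [Matrix.star_eq_conjTranspose, Matrix.conjTranspose_eq_transpose_of_trivial] at this
    · have := hW.spectral_theorem
      rwa [Unitary.conjStarAlgAut_apply, Matrix.star_eq_conjTranspose,
        Matrix.conjTranspose_eq_transpose_of_trivial] at this
  have := h.comp_perm (Tuple.sort hW.eigenvalues)
  rw [sortedEig, dif_pos hW]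
  exact this

theorem HasSymSpectrum.sum_eq_trace {d : ℕ} {W : Matrix (Fin d) (Fin d) ℝ} {x : Fin d → ℝ}
    (h : HasSymSpectrum W x) : ∑ i, x i = W.trace := by
  obtain ⟨Q, hQ, hW⟩ := h
  have h1 : (msym W).trace = W.trace := by
    rw [msym, Matrix.trace_smul, Matrix.trace_add, Matrix.trace_transpose, smul_eq_mul]
    ring
  rw [← h1, hW, Matrix.trace_mul_comm, ← Matrix.mul_assoc, mul_eq_one_comm.1 hQ, Matrix.one_mul,
    Matrix.trace_diagonal]

theorem sum_mul_conj_diagonal {d : ℕ} (V Q : Matrix (Fin d) (Fin d) ℝ) (x y : Fin d → ℝ) :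
    ∑ i, ∑ j, (V * diagonal x * Vᵀ) i j * (Q * diagonal y * Qᵀ) i j =
      ∑ k, ∑ l, x k * y l * ((Vᵀ * Q) k l) ^ 2 := by
  have hs : (Q * diagonal y * Qᵀ)ᵀ = Q * diagonal y * Qᵀ := by
    simp [Matrix.mul_assoc]
  have h1 : ∑ i, ∑ j, (V * diagonal x * Vᵀ) i j * (Q * diagonal y * Qᵀ) i j =
      ((V * diagonal x * Vᵀ) * (Q * diagonal y * Qᵀ)).trace := by
    rw [Matrix.trace]
    refine Finset.sum_congr rfl fun i _ => ?_
    rw [Matrix.diag_apply, Matrix.mul_apply]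
    refine Finset.sum_congr rfl fun j _ => ?_
    rw [← Matrix.transpose_apply (Q * diagonal y * Qᵀ) i j, hs]
  have h2 : ((V * diagonal x * Vᵀ) * (Q * diagonal y * Qᵀ)).trace =
      (diagonal x * ((Vᵀ * Q) * diagonal y * (Vᵀ * Q)ᵀ)).trace := by
    rw [Matrix.mul_assoc V, Matrix.mul_assoc V, Matrix.trace_mul_comm]
    simp only [Matrix.transpose_mul, Matrix.transpose_transpose, Matrix.mul_assoc]
  rw [h1, h2, Matrix.trace]
  refine Finset.sum_congr rfl fun k _ => ?_
  rw [Matrix.diag_apply, Matrix.diagonal_mul, mul_diagonal_mul_transpose_apply, Finset.mul_sum]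
  exact Finset.sum_congr rfl fun l _ => by ring

theorem sum_mul_conj_diagonal_self {d : ℕ} {Q : Matrix (Fin d) (Fin d) ℝ} (hQ : Q * Qᵀ = 1)
    (x y : Fin d → ℝ) :
    ∑ i, ∑ j, (Q * diagonal x * Qᵀ) i j * (Q * diagonal y * Qᵀ) i j = ∑ i, x i * y i := by
  rw [sum_mul_conj_diagonal, mul_eq_one_comm.1 hQ]
  simp [Matrix.one_apply]

/-- Von Neumann's trace inequality for symmetric matrices. -/
theorem sum_mul_conj_diagonal_le {V Q : Matrix (Fin 3) (Fin 3) ℝ} (hV : V * Vᵀ = 1)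
    (hQ : Q * Qᵀ = 1) {x y : Fin 3 → ℝ} (hx : Monotone x) (hy : Monotone y) :
    ∑ i, ∑ j, (V * diagonal x * Vᵀ) i j * (Q * diagonal y * Qᵀ) i j ≤ ∑ i, x i * y i := by
  rw [sum_mul_conj_diagonal]
  set O := Vᵀ * Q with hO
  have h1 : O * Oᵀ = 1 := by
    rw [hO, Matrix.transpose_mul, Matrix.transpose_transpose, Matrix.mul_assoc,
      ← Matrix.mul_assoc Q, hQ, Matrix.one_mul, mul_eq_one_comm.1 hV]
  have h2 : Oᵀ * O = 1 := mul_eq_one_comm.1 h1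
  have hrow : ∀ k, O k 0 ^ 2 + O k 1 ^ 2 + O k 2 ^ 2 = 1 := fun k => by
    have := congrFun (congrFun h1 k) k
    simpa [Matrix.mul_apply, Fin.sum_univ_three, ← sq] using this
  have hcol : ∀ l, O 0 l ^ 2 + O 1 l ^ 2 + O 2 l ^ 2 = 1 := fun k => by
    have := congrFun (congrFun h2 k) k
    simpa [Matrix.mul_apply, Fin.sum_univ_three, ← sq] using this
  have e02 : O 0 2 ^ 2 = 1 - O 1 2 ^ 2 - O 2 2 ^ 2 := by linarith [hcol 2]
  have e01 : O 0 1 ^ 2 = 1 - O 1 1 ^ 2 - O 2 1 ^ 2 := by linarith [hcol 1]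
  have e20 : O 2 0 ^ 2 = 1 - O 2 1 ^ 2 - O 2 2 ^ 2 := by linarith [hrow 2]
  have e10 : O 1 0 ^ 2 = 1 - O 1 1 ^ 2 - O 1 2 ^ 2 := by linarith [hrow 1]
  have e00 : O 0 0 ^ 2 = O 1 1 ^ 2 + O 1 2 ^ 2 + O 2 1 ^ 2 + O 2 2 ^ 2 - 1 := by
    linarith [hrow 0]
  have a := sub_nonneg.2 (hx (show (0 : Fin 3) ≤ 1 by decide))
  have b := sub_nonneg.2 (hx (show (1 : Fin 3) ≤ 2 by decide))
  have c := sub_nonneg.2 (hy (show (0 : Fin 3) ≤ 1 by decide))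
  have d := sub_nonneg.2 (hy (show (1 : Fin 3) ≤ 2 by decide))
  have hac := mul_nonneg (mul_nonneg a c)
    (show 0 ≤ 2 - (O 1 1 ^ 2 + O 1 2 ^ 2 + O 2 1 ^ 2 + O 2 2 ^ 2) by
      nlinarith [hrow 1, hrow 2, sq_nonneg (O 1 0), sq_nonneg (O 2 0)])
  have had := mul_nonneg (mul_nonneg a d)
    (show 0 ≤ 1 - O 1 2 ^ 2 - O 2 2 ^ 2 by linarith [sq_nonneg (O 0 2)])
  have hbc := mul_nonneg (mul_nonneg b c)
    (show 0 ≤ 1 - O 2 1 ^ 2 - O 2 2 ^ 2 by linarith [sq_nonneg (O 2 0)])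
  have hbd := mul_nonneg (mul_nonneg b d)
    (show 0 ≤ 1 - O 2 2 ^ 2 by linarith [sq_nonneg (O 2 0), sq_nonneg (O 2 1)])
  simp only [Fin.sum_univ_three, e00, e01, e02, e10, e20]
  linarith

theorem abs_conj_diagonal_apply_le {d : ℕ} {Q : Matrix (Fin d) (Fin d) ℝ} (hQ : Q * Qᵀ = 1)
    (x : Fin d → ℝ) (i j : Fin d) : |(Q * diagonal x * Qᵀ) i j| ≤ ∑ k, |x k| := by
  have hQ1 : ∀ i k, |Q i k| ≤ 1 := fun i k => by
    have h := congrFun (congrFun hQ i) i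
    rw [Matrix.mul_apply, Matrix.one_apply_eq] at h
    simp only [Matrix.transpose_apply] at h
    rw [← sq_le_one_iff_abs_le_one, sq, ← h]
    exact Finset.single_le_sum (f := fun k => Q i k * Q i k) (fun k _ => mul_self_nonneg _)
      (Finset.mem_univ k)
  rw [mul_diagonal_mul_transpose_apply]
  refine (Finset.abs_sum_le_sum_abs _ _).trans (Finset.sum_le_sum fun k _ => ?_)
  rw [abs_mul, abs_mul]
  calc |Q i k| * |x k| * |Q j k| ≤ 1 * |x k| * 1 := by
        gcongr <;> apply hQ1
    _ = |x k| := by ring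

theorem frobSq_add {d : ℕ} (A B : Matrix (Fin d) (Fin d) ℝ) :
    frobSq (A + B) = frobSq A + 2 * ∑ i, ∑ j, A i j * B i j + frobSq B := by
  simp only [frobSq, Finset.mul_sum, ← Finset.sum_add_distrib, Matrix.add_apply]
  exact Finset.sum_congr rfl fun i _ => Finset.sum_congr rfl fun j _ => by ring

theorem frobSq_sub {d : ℕ} (A B : Matrix (Fin d) (Fin d) ℝ) :
    frobSq (A - B) = frobSq A - 2 * ∑ i, ∑ j, A i j * B i j + frobSq B := by
  simp only [frobSq, Finset.mul_sum, ← Finset.sum_add_distrib, ← Finset.sum_sub_distrib,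
    Matrix.sub_apply]
  exact Finset.sum_congr rfl fun i _ => Finset.sum_congr rfl fun j _ => by ring

theorem frobSq_conj_diagonal {d : ℕ} {Q : Matrix (Fin d) (Fin d) ℝ} (hQ : Q * Qᵀ = 1)
    (x : Fin d → ℝ) : frobSq (Q * diagonal x * Qᵀ) = ∑ i, x i ^ 2 := by
  simpa only [frobSq, sq] using sum_mul_conj_diagonal_self hQ x x

theorem nemV_eq (ρ : Fin 3 → ℝ) (W : Matrix (Fin 3) (Fin 3) ℝ) :
    nemV ρ W = 2 * frobSq (msym W) - 4 * ∑ i, sortedEig (msym W) i * ρ i + 2 * ∑ i, ρ i ^ 2 := by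
  obtain ⟨V, hV, hW⟩ := hasSymSpectrum_sortedEig W
  have h : frobSq (msym W) = ∑ i, sortedEig (msym W) i ^ 2 := by
    conv_lhs => rw [hW]
    exact frobSq_conj_diagonal hV _
  rw [h, nemV]
  simp only [Fin.sum_univ_three]
  ring

theorem sum_msym_mul_conj_diagonal_le (W : Matrix (Fin 3) (Fin 3) ℝ) {Q : Matrix (Fin 3) (Fin 3) ℝ}
    (hQ : Q * Qᵀ = 1) {y : Fin 3 → ℝ} (hy : Monotone y) :
    ∑ i, ∑ j, msym W i j * (Q * diagonal y * Qᵀ) i j ≤ ∑ i, sortedEig (msym W) i * y i := by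
  obtain ⟨V, hV, hW⟩ := hasSymSpectrum_sortedEig W
  have := sum_mul_conj_diagonal_le hV hQ (monotone_sortedEig (msym W)) hy
  rwa [← hW] at this

theorem nemV_le {ρ : Fin 3 → ℝ} (hρ : Monotone ρ) (W : Matrix (Fin 3) (Fin 3) ℝ)
    {Q : Matrix (Fin 3) (Fin 3) ℝ} (hQ : Q * Qᵀ = 1) :
    nemV ρ W ≤ 2 * frobSq (msym W - Q * diagonal ρ * Qᵀ) := by
  rw [nemV_eq, frobSq_sub, frobSq_conj_diagonal hQ]
  linarith [sum_msym_mul_conj_diagonal_le W hQ hρ]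

theorem sum_mul_conj_diagonal_msym {d : ℕ} (W Q : Matrix (Fin d) (Fin d) ℝ) (y : Fin d → ℝ) :
    ∑ i, ∑ j, msym W i j * (Q * diagonal y * Qᵀ) i j =
      ∑ i, ∑ j, W i j * (Q * diagonal y * Qᵀ) i j := by
  have hs : ∀ i j, (Q * diagonal y * Qᵀ) j i = (Q * diagonal y * Qᵀ) i j := fun i j => by
    rw [mul_diagonal_mul_transpose_apply, mul_diagonal_mul_transpose_apply]
    exact Finset.sum_congr rfl fun k _ => by ring
  have h1 : ∑ i, ∑ j, W j i * (Q * diagonal y * Qᵀ) i j =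
      ∑ i, ∑ j, W i j * (Q * diagonal y * Qᵀ) i j := by
    rw [Finset.sum_comm]
    simp only [hs]
  have h2 : ∑ i, ∑ j, msym W i j * (Q * diagonal y * Qᵀ) i j =
      (1 / 2) * (∑ i, ∑ j, W i j * (Q * diagonal y * Qᵀ) i j +
        ∑ i, ∑ j, W j i * (Q * diagonal y * Qᵀ) i j) := by
    simp only [Finset.mul_sum, ← Finset.sum_add_distrib]
    refine Finset.sum_congr rfl fun i _ => Finset.sum_congr rfl fun j _ => ?_
    simp only [msym, Matrix.smul_apply, Matrix.add_apply, Matrix.transpose_apply, smul_eq_mul]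
    ring
  rw [h2, h1]
  ring

theorem le_nemV (ρ : Fin 3 → ℝ) (W : Matrix (Fin 3) (Fin 3) ℝ) {Q : Matrix (Fin 3) (Fin 3) ℝ}
    (hQ : Q * Qᵀ = 1) {s : Fin 3 → ℝ} (hs : Monotone s) :
    4 * ∑ i, ∑ j, W i j * (Q * diagonal s * Qᵀ) i j - 4 * ∑ i, s i * ρ i - 2 * ∑ i, s i ^ 2 ≤
      nemV ρ W := by
  have h := sum_msym_mul_conj_diagonal_le W hQ hs
  rw [sum_mul_conj_diagonal_msym] at h
  rw [nemV]
  simp only [Fin.sum_univ_three] at h ⊢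
  nlinarith [sq_nonneg (sortedEig (msym W) 0 - ρ 0 - s 0),
    sq_nonneg (sortedEig (msym W) 1 - ρ 1 - s 1), sq_nonneg (sortedEig (msym W) 2 - ρ 2 - s 2)]

theorem continuous_nemV {ρ : Fin 3 → ℝ} (hρ : Monotone ρ) : Continuous (nemV ρ) := by
  have hm : Continuous (msym : Matrix (Fin 3) (Fin 3) ℝ → Matrix (Fin 3) (Fin 3) ℝ) := by
    unfold msym
    fun_prop
  set N : Matrix (Fin 3) (Fin 3) ℝ → ℝ := fun W => ∑ i, sortedEig (msym W) i * ρ i with hN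
  have hle : ∀ W W', N W - N W' ≤ (∑ i, ∑ j, |(msym W - msym W') i j|) * ∑ k, |ρ k| := by
    intro W W'
    obtain ⟨V, hV, hW⟩ := hasSymSpectrum_sortedEig W
    have h1 : N W = ∑ i, ∑ j, msym W i j * (V * diagonal ρ * Vᵀ) i j := by
      conv_rhs => rw [hW]
      exact (sum_mul_conj_diagonal_self hV _ _).symm
    have h2 := sum_msym_mul_conj_diagonal_le W' hV hρ
    calc N W - N W' ≤ ∑ i, ∑ j, msym W i j * (V * diagonal ρ * Vᵀ) i j -
          ∑ i, ∑ j, msym W' i j * (V * diagonal ρ * Vᵀ) i j := by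
          rw [h1]
          exact sub_le_sub_left h2 _
      _ = ∑ i, ∑ j, (msym W - msym W') i j * (V * diagonal ρ * Vᵀ) i j := by
          simp only [← Finset.sum_sub_distrib, Matrix.sub_apply, sub_mul]
      _ ≤ _ := by
          simp only [Finset.sum_mul]
          refine Finset.sum_le_sum fun i _ => Finset.sum_le_sum fun j _ => ?_
          refine (le_abs_self _).trans ?_
          rw [abs_mul]
          exact mul_le_mul_of_nonneg_left (abs_conj_diagonal_apply_le hV ρ i j) (abs_nonneg _)
  have hNc : Continuous N := by
    refine continuous_iff_continuousAt.2 fun W' => tendsto_iff_dist_tendsto_zero.2 ?_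
    have h0 : Tendsto (fun W : Matrix (Fin 3) (Fin 3) ℝ =>
        (∑ i, ∑ j, |(msym W - msym W') i j|) * ∑ k, |ρ k|) (nhds W')
        (nhds 0) := by
      have hc : Continuous fun W : Matrix (Fin 3) (Fin 3) ℝ =>
          (∑ i, ∑ j, |(msym W - msym W') i j|) * ∑ k, |ρ k| := by
        fun_prop
      simpa using hc.tendsto W'
    refine squeeze_zero (fun _ => dist_nonneg) (fun W => ?_) h0
    rw [Real.dist_eq, abs_le]
    have h := hle W' W
    rw [show ∑ i, ∑ j, |(msym W' - msym W) i j| = ∑ i, ∑ j, |(msym W - msym W') i j| from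
      Finset.sum_congr rfl fun i _ => Finset.sum_congr rfl fun j _ => abs_sub_comm _ _] at h
    exact ⟨by linarith, hle W W'⟩
  have hf : Continuous fun W : Matrix (Fin 3) (Fin 3) ℝ => frobSq (msym W) := by
    unfold frobSq
    fun_prop
  rw [show nemV ρ = fun W => 2 * frobSq (msym W) - 4 * N W + 2 * ∑ i, ρ i ^ 2 from
    funext fun W => nemV_eq ρ W]
  fun_prop

theorem IsTestField.integrable_jac {d : ℕ} {U : Set (EuclideanSpace ℝ (Fin d))}
    {φ : EuclideanSpace ℝ (Fin d) → EuclideanSpace ℝ (Fin d)} (h : IsTestField U φ) (i j : Fin d) :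
    Integrable fun y => jac φ y i j := by
  refine (continuous_jac h.contDiff i j).integrable_of_hasCompactSupport
    (h.hasCompactSupport.mono' fun y hy => ?_)
  by_contra hy'
  exact hy (by simp [jac_eq_zero_of_notMem_tsupport hy'])

theorem IsTestField.setIntegral_jac {d : ℕ} {U : Set (EuclideanSpace ℝ (Fin d))}
    {φ : EuclideanSpace ℝ (Fin d) → EuclideanSpace ℝ (Fin d)} (h : IsTestField U φ) (i j : Fin d) :
    ∫ y in U, jac φ y i j = 0 := by
  rw [setIntegral_eq_integral_of_forall_compl_eq_zero fun y hy => by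
    simp [jac_eq_zero_of_notMem_tsupport fun hy' => hy (h.tsupport_subset hy')]]
  have hφd : Differentiable ℝ φ := h.contDiff.differentiable (by norm_num)
  have hd : Differentiable ℝ fun y => φ y i :=
    (EuclideanSpace.proj (𝕜 := ℝ) i).differentiable.comp hφd
  have hjac : ∀ y, fderiv ℝ (fun y => φ y i) y (EuclideanSpace.single j 1) = jac φ y i j :=
    fun y => by
      have := ((EuclideanSpace.proj (𝕜 := ℝ) i).hasFDerivAt.comp y (hφd y).hasFDerivAt).fderiv
      exact congrArg (fun L => L (EuclideanSpace.single j 1)) this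
  have hint : Integrable fun y => φ y i :=
    hd.continuous.integrable_of_hasCompactSupport
      (h.hasCompactSupport.comp_left (g := fun v : EuclideanSpace ℝ (Fin d) => v i) rfl)
  have := integral_mul_fderiv_eq_neg_fderiv_mul_of_integrable (μ := volume)
    (f := fun _ : EuclideanSpace ℝ (Fin d) => (1 : ℝ)) (g := fun y => φ y i)
    (v := EuclideanSpace.single j 1) (by simp) (by simpa [hjac] using h.integrable_jac i j)
    (by simpa using hint) (fun _ _ => differentiableAt_const _) fun y _ => hd y
  simpa [hjac] using this

theorem integrableOn_nemV {ρ : Fin 3 → ℝ} (hρ : Monotone ρ) (Z : Matrix (Fin 3) (Fin 3) ℝ)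
    {φ : EuclideanSpace ℝ (Fin 3) → EuclideanSpace ℝ (Fin 3)} (hφ : ContDiff ℝ (⊤ : ℕ∞) φ) :
    IntegrableOn (fun y => nemV ρ (Z + jac φ y)) (Metric.ball 0 1) := by
  have hj : Continuous fun y => jac φ y :=
    continuous_matrix fun i j => continuous_jac hφ i j
  have hc : Continuous fun y => nemV ρ (Z + jac φ y) :=
    (continuous_nemV hρ).comp (continuous_const.add hj)
  exact (hc.continuousOn.integrableOn_compact (isCompact_closedBall 0 1)).mono_set
    Metric.ball_subset_closedBall

theorem volume_unit_ball_pos :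
    0 < (volume (Metric.ball (0 : EuclideanSpace ℝ (Fin 3)) 1)).toReal :=
  ENNReal.toReal_pos (Metric.measure_ball_pos volume 0 one_pos).ne' measure_ball_lt_top.ne

theorem le_average_nemV {ρ : Fin 3 → ℝ} (hρ : Monotone ρ) (Z : Matrix (Fin 3) (Fin 3) ℝ)
    {φ : EuclideanSpace ℝ (Fin 3) → EuclideanSpace ℝ (Fin 3)}
    (hφ : IsTestField (Metric.ball 0 1) φ) {s : Fin 3 → ℝ} (hs : Monotone s) :
    4 * ∑ i, s i * (sortedEig (msym Z) i - ρ i) - 2 * ∑ i, s i ^ 2 ≤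
      (volume (Metric.ball (0 : EuclideanSpace ℝ (Fin 3)) 1)).toReal⁻¹ *
        ∫ y in Metric.ball (0 : EuclideanSpace ℝ (Fin 3)) 1, nemV ρ (Z + jac φ y) := by
  obtain ⟨Q, hQ, hZ⟩ := hasSymSpectrum_sortedEig Z
  set D := Q * diagonal s * Qᵀ with hD
  have hZD : ∑ i, ∑ j, Z i j * D i j = ∑ i, sortedEig (msym Z) i * s i := by
    rw [hD, ← sum_mul_conj_diagonal_msym]
    conv_lhs => rw [hZ]
    exact sum_mul_conj_diagonal_self hQ _ _
  set k : ℝ := 4 * ∑ i, s i * (sortedEig (msym Z) i - ρ i) - 2 * ∑ i, s i ^ 2 with hk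
  have hpt : ∀ y, k + 4 * ∑ i, ∑ j, jac φ y i j * D i j ≤ nemV ρ (Z + jac φ y) := fun y => by
    refine le_of_eq_of_le ?_ (le_nemV ρ (Z + jac φ y) hQ hs)
    rw [← hD]
    simp only [Matrix.add_apply, add_mul, Finset.sum_add_distrib, hZD, hk, mul_sub,
      Finset.sum_sub_distrib]
    simp only [mul_comm (s _)]
    ring
  have hi : ∀ i j, IntegrableOn (fun y => jac φ y i j * D i j)
      (Metric.ball (0 : EuclideanSpace ℝ (Fin 3)) 1) := fun i j =>
    ((hφ.integrable_jac i j).mul_const _).integrableOn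
  have hi' : IntegrableOn (fun y => 4 * ∑ i, ∑ j, jac φ y i j * D i j)
      (Metric.ball (0 : EuclideanSpace ℝ (Fin 3)) 1) :=
    (integrable_finsetSum _ fun i _ => integrable_finsetSum _ fun j _ => hi i j).const_mul 4
  have hk' : IntegrableOn (fun _ => k) (Metric.ball (0 : EuclideanSpace ℝ (Fin 3)) 1) :=
    integrableOn_const measure_ball_lt_top.ne
  have hint : ∫ y in Metric.ball (0 : EuclideanSpace ℝ (Fin 3)) 1,
      (k + 4 * ∑ i, ∑ j, jac φ y i j * D i j) =
        (volume (Metric.ball (0 : EuclideanSpace ℝ (Fin 3)) 1)).toReal * k := by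
    rw [integral_add hk' hi', integral_const_mul,
      integral_finsetSum _ fun i _ => integrable_finsetSum _ fun j _ => hi i j]
    simp_rw [integral_finsetSum Finset.univ fun j _ => hi _ j, integral_mul_const,
      hφ.setIntegral_jac]
    simp [Measure.real]
  rw [le_inv_mul_iff₀ volume_unit_ball_pos, ← hint]
  exact setIntegral_mono (hk'.add hi') (integrableOn_nemV hρ Z hφ.contDiff) hpt

theorem frobSq_le {d : ℕ} {X : Matrix (Fin d) (Fin d) ℝ} {K : ℝ} (h : ∀ i j, |X i j| ≤ K) :
    frobSq X ≤ d * (d * K ^ 2) := by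
  calc frobSq X ≤ ∑ _i : Fin d, ∑ _j : Fin d, K ^ 2 :=
        Finset.sum_le_sum fun i _ => Finset.sum_le_sum fun j _ =>
          sq_le_sq' (neg_le_of_abs_le (h i j)) (le_of_abs_le (h i j))
    _ = d * (d * K ^ 2) := by simp

theorem abs_msym_apply_le {d : ℕ} {X : Matrix (Fin d) (Fin d) ℝ} {K : ℝ} (h : ∀ i j, |X i j| ≤ K)
    (i j : Fin d) : |msym X i j| ≤ K := by
  have h1 := abs_le.1 (h i j)
  have h2 := abs_le.1 (h j i)
  simp only [msym, Matrix.smul_apply, Matrix.add_apply, Matrix.transpose_apply, smul_eq_mul]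
  exact abs_le.2 ⟨by linarith, by linarith⟩

theorem nemV_le_of_near {ρ : Fin 3 → ℝ} (hρ : Monotone ρ) {x : Fin 3 → ℝ}
    {W W' : Matrix (Fin 3) (Fin 3) ℝ} (hW' : HasSymSpectrum W' x) {δ : ℝ} (hδ : δ ≤ 1)
    (h : ∀ i j, |W i j - W' i j| < δ) :
    nemV ρ W ≤ 2 * ∑ i, (x i - ρ i) ^ 2 + δ * (36 * ∑ i, |x i - ρ i| + 18) := by
  obtain ⟨Q, hQ, hW'⟩ := hW'
  have hE : ∀ i j, |msym (W - W') i j| ≤ δ := abs_msym_apply_le fun i j => (h i j).le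
  have hδ0 : 0 ≤ δ := (abs_nonneg _).trans (hE 0 0)
  have hdec : msym W - Q * diagonal ρ * Qᵀ =
      msym (W - W') + Q * diagonal (fun i => x i - ρ i) * Qᵀ := by
    have h1 : msym (W - W') = msym W - msym W' := by
      simp only [msym, ← smul_sub, Matrix.transpose_sub]
      abel_nf
    rw [h1, hW', ← Matrix.diagonal_sub, Matrix.mul_sub, Matrix.sub_mul]
    abel
  have hcross : ∑ i, ∑ j, msym (W - W') i j * (Q * diagonal (fun i => x i - ρ i) * Qᵀ) i j ≤
      9 * (δ * ∑ i, |x i - ρ i|) := by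
    calc _ ≤ ∑ _i : Fin 3, ∑ _j : Fin 3, δ * ∑ i, |x i - ρ i| := by
          refine Finset.sum_le_sum fun i _ => Finset.sum_le_sum fun j _ => ?_
          refine (le_abs_self _).trans ?_
          rw [abs_mul]
          exact mul_le_mul (hE i j) (abs_conj_diagonal_apply_le hQ _ i j) (abs_nonneg _) hδ0
      _ = _ := by
          simp only [Finset.sum_const, Finset.card_univ, Fintype.card_fin, nsmul_eq_mul]
          push_cast
          ring
  have hEE := frobSq_le hE
  push_cast at hEE
  have hle := nemV_le hρ W hQ
  rw [hdec, frobSq_add, frobSq_conj_diagonal hQ] at hle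
  nlinarith

theorem exists_average_nemV_le {ρ : Fin 3 → ℝ} (hρ : Monotone ρ) {x : Fin 3 → ℝ}
    {Z : Matrix (Fin 3) (Fin 3) ℝ} (hZ : IsReachable {W | HasSymSpectrum W x} Z) {η : ℝ}
    (hη : 0 < η) :
    ∃ φ, IsTestField (Metric.ball 0 1) φ ∧
      (volume (Metric.ball (0 : EuclideanSpace ℝ (Fin 3)) 1)).toReal⁻¹ *
        ∫ y in Metric.ball (0 : EuclideanSpace ℝ (Fin 3)) 1, nemV ρ (Z + jac φ y) ≤
          2 * ∑ i, (x i - ρ i) ^ 2 + η := by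
  obtain ⟨C, hC, hreach⟩ := hZ
  set B := Metric.ball (0 : EuclideanSpace ℝ (Fin 3)) 1 with hB
  have hm : 0 < (volume B).toReal := volume_unit_ball_pos
  have hBfin : volume B ≠ ⊤ := measure_ball_lt_top.ne
  set T : ℝ := 2 * ∑ i, (x i - ρ i) ^ 2 with hT
  set R : ℝ := ∑ i, |x i - ρ i| with hR
  have hR0 : 0 ≤ R := Finset.sum_nonneg fun _ _ => abs_nonneg _
  set K : ℝ := ∑ i, ∑ j, |Z i j| + C + ∑ i, |ρ i| with hK
  set M : ℝ := 18 * K ^ 2 with hM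
  have hM0 : 0 ≤ M := by positivity
  have hbound : ∀ J : Matrix (Fin 3) (Fin 3) ℝ, (∀ i j, |J i j| ≤ C) → nemV ρ (Z + J) ≤ M := by
    intro J hJ
    have hone : (1 : Matrix (Fin 3) (Fin 3) ℝ) * 1ᵀ = 1 := by simp
    have h1 : ∀ i j, |(Z + J) i j| ≤ ∑ i, ∑ j, |Z i j| + C := fun i j => by
      rw [Matrix.add_apply]
      refine (abs_add_le _ _).trans (add_le_add ?_ (hJ i j))
      exact (Finset.single_le_sum (f := fun j => |Z i j|) (fun _ _ => abs_nonneg _)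
        (Finset.mem_univ j)).trans (Finset.single_le_sum (f := fun i => ∑ j, |Z i j|)
          (fun _ _ => Finset.sum_nonneg fun _ _ => abs_nonneg _) (Finset.mem_univ i))
    have h2 := frobSq_le (X := msym (Z + J) - 1 * diagonal ρ * 1ᵀ) (K := K) fun i j => by
      rw [Matrix.sub_apply]
      exact (abs_sub _ _).trans
        (add_le_add (abs_msym_apply_le h1 i j) (abs_conj_diagonal_apply_le hone ρ i j))
    push_cast at h2
    linarith [nemV_le hρ (Z + J) hone]
  set δ : ℝ := min 1 (η / 2 / (36 * R + 18)) with hδ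
  have hδ0 : 0 < δ := lt_min one_pos (by positivity)
  have hδη : δ * (36 * R + 18) ≤ η / 2 :=
    (le_div_iff₀ (by positivity)).1 (min_le_right _ _)
  set ε : ℝ := η * (volume B).toReal / (2 * (M + 1)) with hε
  have hε0 : 0 < ε := by positivity
  obtain ⟨φ, V, hφ, hV, hVB, hVε, hφC, hφW⟩ := hreach B Metric.isOpen_ball hBfin
    (ENNReal.ofReal ε) (by simpa using hε0) δ hδ0
  have hVε' : (volume (B \ V)).toReal ≤ ε := ENNReal.toReal_le_of_le_ofReal hε0.le hVε
  have hBV : MeasurableSet (B \ V) := Metric.isOpen_ball.measurableSet.diff hV.measurableSet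
  refine ⟨φ, hφ, ?_⟩
  have hpt : ∀ y ∈ B, nemV ρ (Z + jac φ y) ≤
      (T + η / 2) + (B \ V).indicator (fun _ => M) y := by
    intro y hy
    by_cases hyV : y ∈ V
    · obtain ⟨W, hW, hWd⟩ := hφW y hyV
      have := nemV_le_of_near (W := Z + jac φ y) hρ hW (min_le_left _ _) hWd
      rw [Set.indicator_of_notMem fun h => h.2 hyV]
      linarith
    · rw [Set.indicator_of_mem (show y ∈ B \ V from ⟨hy, hyV⟩)]
      have := hbound _ (hφC y)
      have : 0 ≤ T := by positivity
      linarith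
  have hi1 : IntegrableOn (fun _ => T + η / 2) B := integrableOn_const hBfin
  have hi2 : IntegrableOn ((B \ V).indicator fun _ => M) B :=
    (integrableOn_const hBfin).indicator hBV
  have hle := setIntegral_mono_on (integrableOn_nemV hρ Z hφ.contDiff) (hi1.add hi2)
    Metric.isOpen_ball.measurableSet hpt
  have hint : ∫ y in B, ((T + η / 2) + (B \ V).indicator (fun _ => M) y) =
      (volume B).toReal * (T + η / 2) + (volume (B \ V)).toReal * M := by
    rw [integral_add hi1 hi2, setIntegral_indicator hBV,
      Set.inter_eq_self_of_subset_right Set.sdiff_subset]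
    simp [Measure.real]
  have hεM : ε * M ≤ (volume B).toReal * (η / 2) := by
    have h1 : ε * (M + 1) = (volume B).toReal * (η / 2) := by
      rw [hε]
      field_simp
    linarith
  rw [inv_mul_le_iff₀ hm]
  calc _ ≤ _ := hle
    _ = _ := hint
    _ ≤ (volume B).toReal * (T + η / 2) + ε * M := by gcongr
    _ ≤ _ := by linarith

/-- Explicit relaxation formula (quasiconvexification on incompressible fields) for the
geometrically linearized incompressible nematic elastomer energy. -/
theorem stmt13 (ρ : Fin 3 → ℝ) (hρ01 : ρ 0 ≤ ρ 1) (hρ12 : ρ 1 ≤ ρ 2)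
    (hsum : ρ 0 + ρ 1 + ρ 2 = 0)
    (Z : Matrix (Fin 3) (Fin 3) ℝ) (hZ : Z.trace = 0)
    (g : ℝ)
    (hg : g = sInf { v : ℝ | ∃ φ : EuclideanSpace ℝ (Fin 3) → EuclideanSpace ℝ (Fin 3),
        ContDiff ℝ (⊤ : ℕ∞) φ ∧ HasCompactSupport φ ∧
        tsupport φ ⊆ Metric.ball (0 : EuclideanSpace ℝ (Fin 3)) 1 ∧
        (∀ y, (jac φ y).trace = 0) ∧
        v = (volume (Metric.ball (0 : EuclideanSpace ℝ (Fin 3)) 1)).toReal⁻¹ *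
            ∫ y in Metric.ball (0 : EuclideanSpace ℝ (Fin 3)) 1, nemV ρ (Z + jac φ y) }) :
    (ρ 0 ≤ sortedEig (msym Z) 0 ∧ sortedEig (msym Z) 2 ≤ ρ 2 → g = 0) ∧
    (sortedEig (msym Z) 0 ≤ ρ 0 ∧
        sortedEig (msym Z) 2 - ρ 2 ≤ sortedEig (msym Z) 1 - ρ 1 →
      g = 3 * (sortedEig (msym Z) 0 - ρ 0) ^ 2) ∧
    (sortedEig (msym Z) 0 - ρ 0 ≤ sortedEig (msym Z) 1 - ρ 1 ∧
        sortedEig (msym Z) 1 - ρ 1 ≤ sortedEig (msym Z) 2 - ρ 2 →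
      g = nemV ρ Z) ∧
    (sortedEig (msym Z) 1 - ρ 1 ≤ sortedEig (msym Z) 0 - ρ 0 ∧
        ρ 2 ≤ sortedEig (msym Z) 2 →
      g = 3 * (sortedEig (msym Z) 2 - ρ 2) ^ 2) := by
  have hmono : ∀ {s : Fin 3 → ℝ}, s 0 ≤ s 1 → s 1 ≤ s 2 → Monotone s := fun h h' =>
    Fin.monotone_iff_le_succ.2 fun i => by fin_cases i <;> assumption
  have hρ : Monotone ρ := hmono hρ01 hρ12
  have hlower : ∀ {s : Fin 3 → ℝ}, Monotone s →
      4 * ∑ i, s i * (sortedEig (msym Z) i - ρ i) - 2 * ∑ i, s i ^ 2 ≤ g := by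
    intro s hs
    rw [hg]
    have h0 := IsTestField.zero (Metric.ball (0 : EuclideanSpace ℝ (Fin 3)) 1)
    refine le_csInf
      ⟨_, 0, h0.contDiff, h0.hasCompactSupport, h0.tsupport_subset, h0.trace_jac, rfl⟩ ?_
    rintro _ ⟨φ, h1, h2, h3, h4, rfl⟩
    exact le_average_nemV hρ Z ⟨h1, h2, h3, h4⟩ hs
  have hZs := (hasSymSpectrum_sortedEig Z).sum_eq_trace
  have hZv : HasSymSpectrum Z
      ![sortedEig (msym Z) 0, sortedEig (msym Z) 1, sortedEig (msym Z) 2] := by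
    convert hasSymSpectrum_sortedEig Z using 1
    ext i
    fin_cases i <;> rfl
  have h01 := monotone_sortedEig (msym Z) (show (0 : Fin 3) ≤ 1 by decide)
  have h12 := monotone_sortedEig (msym Z) (show (1 : Fin 3) ≤ 2 by decide)
  rw [hZ, Fin.sum_univ_three] at hZs
  have hupper : ∀ {x₀ x₁ x₂ : ℝ}, x₀ ≤ sortedEig (msym Z) 0 → sortedEig (msym Z) 2 ≤ x₂ →
      x₀ + x₁ + x₂ = 0 → g ≤ 2 * ((x₀ - ρ 0) ^ 2 + (x₁ - ρ 1) ^ 2 + (x₂ - ρ 2) ^ 2) := by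
    intro x₀ x₁ x₂ h0 h2 hx
    have hreach := isReachable_of_majorized h01 h12 h0 h2 (hZs.trans hx.symm) hZv
    refine le_of_forall_pos_le_add fun η hη => ?_
    obtain ⟨φ, hφ, hle⟩ := exists_average_nemV_le hρ hreach hη
    rw [Fin.sum_univ_three] at hle
    refine le_trans ?_ hle
    rw [hg]
    refine csInf_le ⟨4 * ∑ i, (0 : ℝ) * (sortedEig (msym Z) i - ρ i) - 2 * ∑ _i : Fin 3, 0 ^ 2, ?_⟩
      ⟨φ, hφ.contDiff, hφ.hasCompactSupport, hφ.tsupport_subset, hφ.trace_jac, rfl⟩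
    rintro _ ⟨ψ, h1, h2, h3, h4, rfl⟩
    exact le_average_nemV hρ Z ⟨h1, h2, h3, h4⟩ (s := fun _ => 0) monotone_const
  simp only [Fin.sum_univ_three] at hlower
  simp only [nemV, Fin.sum_univ_three]
  clear hg hZv
  generalize sortedEig (msym Z) = l at *
  refine ⟨fun ⟨h, h'⟩ => le_antisymm ?_ ?_, fun ⟨h, h'⟩ => le_antisymm ?_ ?_,
    fun ⟨h, h'⟩ => le_antisymm ?_ ?_, fun ⟨h, h'⟩ => le_antisymm ?_ ?_⟩
  · exact (hupper h h' hsum).trans_eq (by ring)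
  · simpa using hlower (s := fun _ => 0) monotone_const
  · exact (hupper (x₁ := ρ 1 - (l 0 - ρ 0) / 2) (x₂ := ρ 2 - (l 0 - ρ 0) / 2) le_rfl
      (by linarith) (by linarith)).trans_eq (by ring)
  · refine le_of_eq_of_le ?_ (hlower (s := ![l 0 - ρ 0, -(l 0 - ρ 0) / 2, -(l 0 - ρ 0) / 2])
      (hmono (by simp; linarith) (by simp)))
    simp
    linear_combination (2 * (l 0 - ρ 0)) * (hZs - hsum)
  · exact hupper le_rfl le_rfl hZs
  · exact le_of_eq_of_le (by ring) (hlower (s := fun i => l i - ρ i) (hmono h h'))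
  · exact (hupper (x₀ := ρ 0 - (l 2 - ρ 2) / 2) (x₁ := ρ 1 - (l 2 - ρ 2) / 2) (by linarith)
      le_rfl (by linarith)).trans_eq (by ring)
  · refine le_of_eq_of_le ?_ (hlower (s := ![-(l 2 - ρ 2) / 2, -(l 2 - ρ 2) / 2, l 2 - ρ 2])
      (hmono (by simp) (by simp; linarith)))
    simp
    linear_combination (2 * (l 2 - ρ 2)) * (hZs - hsum)
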